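/- arXiv:1810.00993 — 3 statements merged into one kernel-verified Lean document; each statement's English description precedes it below -/
import Mathlib

section
/- For all n ≥ 4, b(n,3) = p(n,3) = 4·E(n−1,3) − (C(n,3) − C(n,2) + 4)·2^{n−2} − 22·C(n,5) + 16·C(n,4) − 4·C(n,3) + 2n, where C(n,k) denotes the binomial coefficient. -/
open Finset
open scoped Classical

/-- The one-line word of a permutation of `Fin n`, with values in `{1, …, n}`. -/
def permWord {n : ℕ} (π : Equiv.Perm (Fin n)) : List ℕ :=
  (List.finRange n).map fun i => (π i : ℕ) + 1

/-- The set of (0-indexed) ascent positions of a word. Position `i` (for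
`0 ≤ i ≤ length - 2`) is an ascent if `w_i < w_{i+1}`. -/
def ascentSet (w : List ℕ) : Finset ℕ :=
  (Finset.range (w.length - 1)).filter fun i => w.getD i 0 < w.getD (i + 1) 0

/-- The set of (0-indexed) descent positions of a word. Position `i` (for
`0 ≤ i ≤ length - 2`) is a descent if `w_i > w_{i+1}`. -/
def descentSet (w : List ℕ) : Finset ℕ :=
  (Finset.range (w.length - 1)).filter fun i => w.getD (i + 1) 0 < w.getD i 0

/-- The number of descents of a permutation. -/
def descentCount {n : ℕ} (π : Equiv.Perm (Fin n)) : ℕ :=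
  (descentSet (permWord π)).card

/-- A permutation is ballot if every prefix of its one-line notation has at least
as many ascents as descents. -/
def IsBallot {n : ℕ} (π : Equiv.Perm (Fin n)) : Prop :=
  ∀ k, k ≤ n →
    (descentSet ((permWord π).take k)).card ≤ (ascentSet ((permWord π).take k)).card

/-- The Eulerian number `E(n,d)`: the number of permutations of `{1,…,n}` with
exactly `d` descents.  (`E(0,0) = 1` and `E(0,d) = 0` for `d ≥ 1`.) -/
noncomputable def eulerianNum (n d : ℕ) : ℕ :=
  (Finset.univ.filter fun π : Equiv.Perm (Fin n) => descentCount π = d).card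

/-- `M(c)` for a cycle `c`: the minimum of the number of cyclic ascents and the
number of cyclic descents of `c`. -/
noncomputable def cycleM {n : ℕ} (c : Equiv.Perm (Fin n)) : ℕ :=
  min ((c.support.filter fun x => x < c x).card) ((c.support.filter fun x => c x < x).card)

/-- `M(π)`: the sum of `M(c)` over the cycles `c` of the cycle decomposition of `π`
(fixed points contribute `0`). -/
noncomputable def permM {n : ℕ} (π : Equiv.Perm (Fin n)) : ℕ :=
  ∑ c ∈ π.cycleFactorsFinset, cycleM c

/-- The number of ballot permutations of `{1,…,n}`. -/
noncomputable def ballotTotal (n : ℕ) : ℕ :=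
  (Finset.univ.filter fun π : Equiv.Perm (Fin n) => IsBallot π).card

/-- The number of permutations of `{1,…,n}` of odd order. -/
noncomputable def oddOrderTotal (n : ℕ) : ℕ :=
  (Finset.univ.filter fun π : Equiv.Perm (Fin n) => Odd (orderOf π)).card

/-- `b(n,d)`: the number of ballot permutations of `{1,…,n}` with exactly `d` descents. -/
noncomputable def bCount (n d : ℕ) : ℕ :=
  (Finset.univ.filter fun π : Equiv.Perm (Fin n) => IsBallot π ∧ descentCount π = d).card

/-- `p(n,d)`: the number of odd order permutations `π` of `{1,…,n}` with `M(π) = d`. -/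
noncomputable def pCount (n d : ℕ) : ℕ :=
  (Finset.univ.filter fun π : Equiv.Perm (Fin n) => Odd (orderOf π) ∧ permM π = d).card

/-- The Eulerian–Catalan numbers: `EC(n) = 2·E(2n, n-1)`, with `EC(0) = 1`. -/
noncomputable def eulerianCatalan (n : ℕ) : ℕ :=
  if n = 0 then 1 else 2 * eulerianNum (2 * n) (n - 1)

/-- The arrangements of a finite set `A`: the duplicate-free lists with underlying set `A`. -/
noncomputable def arrangements {α : Type*} (A : Finset α) : Finset (List α) :=
  A.toList.permutations.toFinset

theorem mem_arrangements {α : Type*} {A : Finset α} {l : List α} :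
    l ∈ arrangements A ↔ l.Nodup ∧ ∀ x, x ∈ l ↔ x ∈ A := by
  unfold arrangements
  rw [List.mem_toFinset, List.mem_permutations]
  constructor
  · intro h
    exact ⟨h.nodup_iff.2 A.nodup_toList, fun x => by rw [h.mem_iff, Finset.mem_toList]⟩
  · rintro ⟨h1, h2⟩
    rw [List.perm_ext_iff_of_nodup h1 A.nodup_toList]
    simpa using h2

theorem length_of_mem_arrangements {α : Type*} {A : Finset α} {l : List α}
    (h : l ∈ arrangements A) : l.length = A.card := by
  rw [mem_arrangements] at h
  rw [← List.toFinset_card_of_nodup h.1]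
  congr 1
  ext x
  simp [h.2]

theorem card_arrangements {α : Type*} (A : Finset α) :
    (arrangements A).card = A.card.factorial := by
  rw [← Finset.length_toList A, ← List.length_permutations]
  exact List.toFinset_card_of_nodup (List.nodup_permutations _ A.nodup_toList)

theorem arrangements_empty {α : Type*} : arrangements (∅ : Finset α) = {[]} := by
  simp [arrangements]

/-- Cutting an arrangement of `A` after its first `k` entries. -/
theorem sum_arrangements_take_drop {α R : Type*} [DecidableEq α] [AddCommMonoid R]
    (A : Finset α) {k : ℕ}
    (hk : k ≤ A.card) (F : List α → List α → R) :
    ∑ l ∈ arrangements A, F (l.take k) (l.drop k) =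
      ∑ B ∈ A.powersetCard k, ∑ l₁ ∈ arrangements B, ∑ l₂ ∈ arrangements (A \ B), F l₁ l₂ := by
  simp_rw [← Finset.sum_product']
  rw [Finset.sum_sigma']
  symm
  refine Finset.sum_bij (fun x _ => x.2.1 ++ x.2.2) ?_ ?_ ?_ ?_
  · rintro ⟨B, l₁, l₂⟩ h
    simp only [Finset.mem_sigma, Finset.mem_powersetCard, Finset.mem_product,
      mem_arrangements, Finset.mem_sdiff] at h ⊢
    obtain ⟨⟨hB, -⟩, ⟨h1, h1'⟩, h2, h2'⟩ := h
    refine ⟨List.nodup_append'.2 ⟨h1, h2, fun x hx hx' => ?_⟩, fun x => ?_⟩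
    · exact ((h2' x).1 hx').2 ((h1' x).1 hx)
    · rw [List.mem_append, h1', h2']
      have := @hB x
      tauto
  · rintro ⟨B, l₁, l₂⟩ h ⟨B', l₁', l₂'⟩ h' heq
    simp only [Finset.mem_sigma, Finset.mem_powersetCard, Finset.mem_product] at h h'
    obtain ⟨⟨hB, hc⟩, h1, h2⟩ := h
    obtain ⟨⟨hB', hc'⟩, h1', h2'⟩ := h'
    obtain ⟨rfl, rfl⟩ := List.append_inj heq
      (by rw [length_of_mem_arrangements h1, length_of_mem_arrangements h1', hc, hc'])
    have : B = B' := by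
      ext x
      rw [← (mem_arrangements.1 h1).2, (mem_arrangements.1 h1').2]
    subst this
    rfl
  · intro l hl
    have hlen := length_of_mem_arrangements hl
    rw [mem_arrangements] at hl
    have hd : (l.take k ++ l.drop k).Nodup := by rw [List.take_append_drop]; exact hl.1
    rw [List.nodup_append'] at hd
    refine ⟨⟨(l.take k).toFinset, l.take k, l.drop k⟩, ?_, List.take_append_drop k l⟩
    simp only [Finset.mem_sigma, Finset.mem_powersetCard, Finset.mem_product, mem_arrangements,
      Finset.mem_sdiff, List.mem_toFinset]
    refine ⟨⟨fun x hx => ?_, ?_⟩, ⟨hd.1, fun x => by simp⟩, hd.2.1, fun x => ?_⟩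
    · exact (hl.2 x).1 (List.mem_of_mem_take (by simpa using hx))
    · rw [List.toFinset_card_of_nodup hd.1, List.length_take]
      omega
    · rw [← hl.2]
      refine ⟨fun hx => ⟨List.mem_of_mem_drop hx, fun hx' => hd.2.2 hx' hx⟩, fun hx => ?_⟩
      have := hx.1
      rw [← List.take_append_drop k l, List.mem_append] at this
      tauto
  · rintro ⟨B, l₁, l₂⟩ h
    simp only [Finset.mem_sigma, Finset.mem_powersetCard, Finset.mem_product] at h
    have := length_of_mem_arrangements h.2.1
    rw [h.1.2] at this
    simp [List.take_left' this, List.drop_left' this]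

/-- Splitting an arrangement of `insert a A` at the entry `a`. -/
theorem sum_arrangements_insert {α R : Type*} [DecidableEq α] [AddCommMonoid R] {A : Finset α}
    {a : α} (ha : a ∉ A) (F : List α → R) :
    ∑ l ∈ arrangements (insert a A), F l =
      ∑ B ∈ A.powerset, ∑ l₁ ∈ arrangements B, ∑ l₂ ∈ arrangements (A \ B),
        F (l₁ ++ a :: l₂) := by
  simp_rw [← Finset.sum_product']
  rw [Finset.sum_sigma']
  symm
  refine Finset.sum_bij (fun x _ => x.2.1 ++ a :: x.2.2) ?_ ?_ ?_ ?_
  · rintro ⟨B, l₁, l₂⟩ h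
    simp only [Finset.mem_sigma, Finset.mem_powerset, Finset.mem_product,
      mem_arrangements, Finset.mem_sdiff, Finset.mem_insert] at h ⊢
    obtain ⟨hB, ⟨h1, h1'⟩, h2, h2'⟩ := h
    have ha1 : a ∉ l₁ := fun h => ha (hB ((h1' a).1 h))
    have ha2 : a ∉ l₂ := fun h => ha ((h2' a).1 h).1
    refine ⟨List.nodup_append'.2 ⟨h1, List.nodup_cons.2 ⟨ha2, h2⟩, fun x hx hx' => ?_⟩,
      fun x => ?_⟩
    · rcases List.mem_cons.1 hx' with rfl | hx'
      · exact ha1 hx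
      · exact ((h2' x).1 hx').2 ((h1' x).1 hx)
    · rw [List.mem_append, List.mem_cons, h1', h2']
      have := @hB x
      tauto
  · rintro ⟨B, l₁, l₂⟩ h ⟨B', l₁', l₂'⟩ h' heq
    simp only [Finset.mem_sigma, Finset.mem_powerset, Finset.mem_product,
      mem_arrangements, Finset.mem_sdiff] at h h' heq
    obtain ⟨hB, ⟨h1, h1m⟩, h2, h2m⟩ := h
    obtain ⟨hB', ⟨h1', h1m'⟩, h2', h2m'⟩ := h'
    have ha1 : a ∉ l₁ := fun h => ha (hB ((h1m a).1 h))
    have ha2 : a ∉ l₂ := fun h => ha ((h2m a).1 h).1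
    obtain ⟨rfl, -, rfl⟩ := (List.append_cons_inj_of_notMem ha1 ha2).1 heq
    have : B = B' := by
      ext x
      rw [← h1m, h1m']
    subst this
    rfl
  · intro l hl
    rw [mem_arrangements] at hl
    obtain ⟨l₁, l₂, rfl⟩ := List.append_of_mem ((hl.2 a).2 (Finset.mem_insert_self a A))
    obtain ⟨hd, hm⟩ := hl
    rw [List.nodup_append', List.nodup_cons] at hd
    obtain ⟨h1, ⟨ha2, h2⟩, hdis⟩ := hd
    have ha1 : a ∉ l₁ := fun h => hdis h (List.mem_cons_self)
    refine ⟨⟨l₁.toFinset, l₁, l₂⟩, ?_, rfl⟩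
    simp only [Finset.mem_sigma, Finset.mem_powerset, Finset.mem_product, mem_arrangements,
      Finset.mem_sdiff, List.mem_toFinset]
    simp only [List.mem_append, List.mem_cons, Finset.mem_insert] at hm
    refine ⟨fun x hx => ?_, ⟨h1, fun x => by simp⟩, h2, fun x => ?_⟩
    · rw [List.mem_toFinset] at hx
      rcases (hm x).1 (Or.inl hx) with rfl | h
      · exact absurd hx ha1
      · exact h
    · constructor
      · intro hx
        refine ⟨?_, fun hx' => hdis hx' (List.mem_cons_of_mem _ hx)⟩
        rcases (hm x).1 (Or.inr (Or.inr hx)) with rfl | h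
        · exact absurd hx ha2
        · exact h
      · rintro ⟨hx, hx'⟩
        rcases (hm x).2 (Or.inr hx) with h | rfl | h
        · exact absurd h hx'
        · exact absurd hx ha
        · exact h
  · intro x _
    rfl

section Words

variable {α : Type*} [LinearOrder α]

/-- The descent word of a list: its `i`-th letter tells whether position `i` is a descent. -/
def descentWord : List α → List Bool
  | [] => []
  | [_] => []
  | a :: b :: l => decide (b < a) :: descentWord (b :: l)

/-- The number of descents of a list. -/
def des (l : List α) : ℕ := (descentWord l).count true

theorem length_descentWord : ∀ l : List α, (descentWord l).length = l.length - 1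
  | [] => rfl
  | [_] => rfl
  | a :: b :: l => by simp [descentWord, length_descentWord (b :: l)]

theorem descentWord_take : ∀ (k : ℕ) (l : List α),
    descentWord (l.take (k + 1)) = (descentWord l).take k
  | _, [] => by simp [descentWord]
  | _, [_] => by simp [descentWord]
  | 0, a :: b :: l => by simp [descentWord]
  | k + 1, a :: b :: l => by
    have := descentWord_take k (b :: l)
    simp only [List.take_succ_cons] at this
    simp [descentWord, this]

theorem descentWord_drop : ∀ (k : ℕ) (l : List α),
    descentWord (l.drop k) = (descentWord l).drop k
  | _, [] => by simp [descentWord]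
  | 0, [_] => by simp
  | k + 1, [_] => by simp [descentWord]
  | 0, a :: b :: l => by simp
  | k + 1, a :: b :: l => by
    simp [descentWord, descentWord_drop k (b :: l)]

theorem descentWord_append_cons : ∀ (l₁ : List α) (a : α) (l₂ : List α),
    descentWord (l₁ ++ a :: l₂) = descentWord (l₁ ++ [a]) ++ descentWord (a :: l₂)
  | [], _, _ => by simp [descentWord]
  | [_], _, _ => by simp [descentWord]
  | b :: c :: l, a, l₂ => by
    have := descentWord_append_cons (c :: l) a l₂
    simp only [List.cons_append] at this
    simp [descentWord, this]

theorem des_append_singleton : ∀ (l : List α) (a : α), (∀ x ∈ l, x < a) →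
    des (l ++ [a]) = des l
  | [], _, _ => by simp [des, descentWord]
  | [b], a, h => by
    have : b < a := h b (by simp)
    simp [des, descentWord, this.le]
  | b :: c :: l, a, h => by
    have := des_append_singleton (c :: l) a (fun x hx => h x (List.mem_cons_of_mem _ hx))
    simp only [des, List.cons_append] at this
    simp [des, descentWord, List.count_cons, this]

theorem des_cons_of_lt (a : α) (l : List α) (h : ∀ x ∈ l, x < a) :
    des (a :: l) = if l = [] then 0 else 1 + des l := by
  cases l with
  | nil => simp [des, descentWord]
  | cons b l =>
    have : b < a := h b (by simp)
    simp [des, descentWord, this, add_comm]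

theorem des_append_cons_of_lt (l₁ : List α) (a : α) (l₂ : List α) (h₁ : ∀ x ∈ l₁, x < a)
    (h₂ : ∀ x ∈ l₂, x < a) :
    des (l₁ ++ a :: l₂) = des l₁ + if l₂ = [] then 0 else 1 + des l₂ := by
  rw [← des_cons_of_lt a l₂ h₂, ← des_append_singleton l₁ a h₁, des, descentWord_append_cons,
    List.count_append, des, des]

theorem descentWord_reverse : ∀ l : List α, l.Nodup →
    descentWord l.reverse = ((descentWord l).map not).reverse
  | [], _ => rfl
  | [_], _ => rfl
  | a :: b :: l, h => by
    have ih := descentWord_reverse (b :: l) (List.nodup_cons.1 h).2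
    have hab : a ≠ b := by
      rintro rfl
      simp at h
    rw [List.reverse_cons, List.reverse_cons, List.append_assoc, List.singleton_append,
      descentWord_append_cons, ← List.reverse_cons, ih]
    rcases lt_or_gt_of_ne hab with h' | h' <;> simp [descentWord, h', h'.not_gt]

theorem count_true_map_not : ∀ w : List Bool, (w.map not).count true + w.count true = w.length
  | [] => rfl
  | true :: w => by
    have := count_true_map_not w
    simp only [List.map_cons, List.count_cons, List.length_cons]
    simp
    omega
  | false :: w => by
    have := count_true_map_not w
    simp only [List.map_cons, List.count_cons, List.length_cons]
    simp
    omega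

theorem des_reverse_add_des {l : List α} (h : l.Nodup) :
    des l.reverse + des l = l.length - 1 := by
  rw [des, descentWord_reverse l h, List.count_reverse, des, count_true_map_not,
    length_descentWord]

theorem des_le (l : List α) : des l ≤ l.length - 1 :=
  (List.count_le_length).trans (length_descentWord l).le

end Words

section GeneratingFunctions

open PowerSeries

/-- `HasEgf A f F` says that the polynomials `f B`, for `B ⊆ A`, have their coefficients of degree
at most three enumerated by the exponential generating functions `F d`, according to the
cardinality of `B`. -/
def HasEgf {α : Type*} (A : Finset α) (f : Finset α → Polynomial ℚ) (F : ℕ → ℚ⟦X⟧) : Prop :=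
  ∀ B ⊆ A, ∀ d ≤ 3, (f B).coeff d = B.card.factorial * coeff B.card (F d)

/-- The binomial convolution of set functions corresponds to the product of exponential
generating functions. -/
theorem HasEgf.coeff_convolution {α : Type*} [DecidableEq α] {A : Finset α}
    {f g : Finset α → Polynomial ℚ} {F G : ℕ → ℚ⟦X⟧} (hf : HasEgf A f F)
    (hg : HasEgf A g G) {d : ℕ} (hd : d ≤ 3) :
    (∑ B ∈ A.powerset, f B * g (A \ B)).coeff d =
      A.card.factorial * coeff A.card (∑ ij ∈ antidiagonal d, F ij.1 * G ij.2) := by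
  rw [Polynomial.finsetSum_coeff, map_sum, Finset.mul_sum]
  simp_rw [Polynomial.coeff_mul]
  rw [Finset.sum_comm]
  refine Finset.sum_congr rfl fun ij hij => ?_
  rw [HasAntidiagonal.mem_antidiagonal] at hij
  have key : ∀ B ∈ A.powerset, (f B).coeff ij.1 * (g (A \ B)).coeff ij.2 =
      (fun k : ℕ => (k.factorial : ℚ) * coeff k (F ij.1) *
        ((A.card - k).factorial * coeff (A.card - k) (G ij.2))) B.card := by
    intro B hB
    rw [Finset.mem_powerset] at hB
    rw [hf B hB _ (by omega), hg _ Finset.sdiff_subset _ (by omega),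
      Finset.card_sdiff_of_subset hB]
  rw [Finset.sum_congr rfl key, Finset.sum_powerset_apply_card (fun k : ℕ =>
    (k.factorial : ℚ) * coeff k (F ij.1) *
      ((A.card - k).factorial * coeff (A.card - k) (G ij.2)))]
  rw [coeff_mul,
    Finset.Nat.sum_antidiagonal_eq_sum_range_succ (fun i j => coeff i (F ij.1) * coeff j (G ij.2)),
    Finset.mul_sum]
  refine Finset.sum_congr rfl fun k hk => ?_
  rw [Finset.mem_range] at hk
  rw [nsmul_eq_mul, ← Nat.choose_mul_factorial_mul_factorial (Nat.le_of_lt_succ hk)]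
  push_cast
  ring

theorem HasEgf.mono {α : Type*} {A B : Finset α} {f : Finset α → Polynomial ℚ}
    {F : ℕ → ℚ⟦X⟧} (hf : HasEgf A f F) (h : B ⊆ A) : HasEgf B f F :=
  fun _ hC => hf _ (hC.trans h)

theorem factorial_succ_mul_coeff_succ (F : ℚ⟦X⟧) (n : ℕ) :
    ((n + 1).factorial : ℚ) * coeff (n + 1) F = n.factorial * coeff n (derivative ℚ F) := by
  rw [coeff_derivative, Nat.factorial_succ]
  push_cast
  ring

/-- A family of polynomials satisfying a recursion by convolution is enumerated by the solution
of the corresponding system of differential equations. -/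
theorem hasEgf_of_insert {α : Type*} [LinearOrder α] {f : Finset α → Polynomial ℚ}
    {g : Finset α → Polynomial ℚ} {F G : ℕ → ℚ⟦X⟧}
    (h0 : ∀ d ≤ 3, (f ∅).coeff d = constantCoeff (F d))
    (hins : ∀ (A : Finset α) (a : α), (∀ x ∈ A, x < a) → HasEgf A f F → HasEgf A g G ∧
      f (insert a A) = ∑ B ∈ A.powerset, g B * f (A \ B))
    (hder : ∀ d ≤ 3, derivative ℚ (F d) = ∑ ij ∈ antidiagonal d, G ij.1 * F ij.2)
    (A : Finset α) : HasEgf A f F := by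
  induction A using Finset.induction_on_max with
  | empty =>
    intro B hB d hd
    rw [Finset.subset_empty.1 hB, h0 d hd]
    simp
  | insert a A ha ih =>
    intro B hB d hd
    by_cases haB : a ∈ B
    · have hsub : B.erase a ⊆ A := by
        intro x hx
        rw [Finset.mem_erase] at hx
        exact (Finset.mem_insert.1 (hB hx.2)).resolve_left hx.1
      obtain ⟨hg, hrec⟩ := hins (B.erase a) a (fun x hx => ha x (hsub hx)) (ih.mono hsub)
      rw [Finset.insert_erase haB] at hrec
      rw [hrec, hg.coeff_convolution (ih.mono hsub) hd, ← hder d hd,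
        ← factorial_succ_mul_coeff_succ, Finset.card_erase_add_one haB]
    · refine ih B (fun x hx => (Finset.mem_insert.1 (hB hx)).resolve_left ?_) d hd
      rintro rfl
      exact haB hx

theorem factorial_mul_coeff_X_pow_mul_exp_pow (a b n : ℕ) :
    (n.factorial : ℚ) * coeff n ((X : ℚ⟦X⟧) ^ a * exp ℚ ^ b) =
      n.descFactorial a * (b : ℚ) ^ (n - a) := by
  rw [coeff_X_pow_mul']
  split_ifs with h
  · rw [exp_pow_eq_rescale_exp, coeff_rescale, coeff_exp, ← Nat.factorial_mul_descFactorial h]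
    have : ((n - a).factorial : ℚ) ≠ 0 := by positivity
    simp
    field_simp
  · rw [Nat.descFactorial_of_lt (by omega)]
    simp

end GeneratingFunctions

section Eulerian

open PowerSeries

/-- The exponential generating functions of the Eulerian numbers `E(n,d)` for `d ≤ 3`. -/
noncomputable def eulerianEgf : ℕ → ℚ⟦X⟧
  | 0 => exp ℚ
  | 1 => exp ℚ ^ 2 - exp ℚ - X * exp ℚ
  | 2 => exp ℚ ^ 3 - exp ℚ ^ 2 - 2 * X * exp ℚ ^ 2 + X * exp ℚ + C (1 / 2) * X ^ 2 * exp ℚ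
  | 3 => exp ℚ ^ 4 - exp ℚ ^ 3 - 3 * X * exp ℚ ^ 3 + 2 * X * exp ℚ ^ 2 + 2 * X ^ 2 * exp ℚ ^ 2
      - C (1 / 2) * X ^ 2 * exp ℚ - C (1 / 6) * X ^ 3 * exp ℚ
  | _ => 0

/-- The generating functions of the descents of the words that start with a maximal letter. -/
noncomputable def tailEgf : ℕ → ℚ⟦X⟧
  | 0 => 1
  | 1 => eulerianEgf 0 - 1
  | d + 1 => eulerianEgf d

theorem derivative_eulerianEgf {d : ℕ} (hd : d ≤ 3) :
    derivative ℚ (eulerianEgf d) =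
      ∑ ij ∈ antidiagonal d, tailEgf ij.1 * eulerianEgf ij.2 := by
  have hC (q : ℚ) : derivative ℚ (C q) = 0 := derivative_C
  have h2 : (2 : ℚ⟦X⟧) * C (1 / 2 : ℚ) = 1 := by
    rw [← map_ofNat C 2, ← map_mul]; norm_num
  have h6 : (6 : ℚ⟦X⟧) * C (1 / 6 : ℚ) = 1 := by
    rw [← map_ofNat C 6, ← map_mul]; norm_num
  have hn (n : ℕ) [n.AtLeastTwo] : derivative ℚ (OfNat.ofNat n : ℚ⟦X⟧) = 0 :=
    Derivation.map_natCast _ n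
  interval_cases d <;>
    simp only [Finset.Nat.antidiagonal_succ, Finset.Nat.antidiagonal_zero, eulerianEgf, tailEgf,
      Finset.sum_cons, Finset.sum_singleton, Finset.map_singleton,
      Finset.map_cons, map_add, map_sub, Derivation.leibniz, Derivation.leibniz_pow,
      derivative_exp, derivative_X, smul_eq_mul, nsmul_eq_mul, hC, hn,
      Function.Embedding.coeFn_mk, Function.Embedding.prodMap, Prod.map,
      Function.Embedding.refl_apply, Nat.succ_eq_add_one] <;> norm_num
  · ring
  · linear_combination (X * exp ℚ) * h2
  · linear_combination (-X * exp ℚ - X ^ 2 * exp ℚ ^ 2 + 3 * X ^ 2 * exp ℚ * C (1 / 6)) * h2 -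
      (X ^ 2 * exp ℚ * C (1 / 2)) * h6

variable {α : Type*} [LinearOrder α]

/-- The descent polynomial of the arrangements of `A`. -/
noncomputable def eulerianPoly (A : Finset α) : Polynomial ℚ :=
  ∑ l ∈ arrangements A, Polynomial.X ^ des l

theorem coeff_eulerianPoly (A : Finset α) (d : ℕ) :
    (eulerianPoly A).coeff d = ((arrangements A).filter fun l => des l = d).card := by
  simp [eulerianPoly, Polynomial.coeff_X_pow, Finset.sum_boole, eq_comm]

theorem eulerianPoly_empty : eulerianPoly (∅ : Finset α) = 1 := by
  simp [eulerianPoly, arrangements_empty, des, descentWord]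

/-- The descent polynomial of the words starting with a maximal letter, followed by an
arrangement of `A`. -/
noncomputable def tailPoly (A : Finset α) : Polynomial ℚ :=
  if A = ∅ then 1 else Polynomial.X * eulerianPoly A

theorem HasEgf.tailPoly {A : Finset α} (h : HasEgf A eulerianPoly eulerianEgf) :
    HasEgf A tailPoly tailEgf := by
  intro B hB d hd
  have hB' := h B hB
  rw [_root_.tailPoly]
  split_ifs with hemp
  · subst hemp
    rw [Finset.card_empty]
    interval_cases d <;> simp [eulerianEgf, tailEgf, Polynomial.coeff_one]
  · have hpos : B.card ≠ 0 := fun h => hemp (Finset.card_eq_zero.1 h)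
    cases d with
    | zero => simp [tailEgf, coeff_one, hpos]
    | succ d =>
      rw [Polynomial.coeff_X_mul, hB' d (by omega)]
      cases d with
      | zero => simp [tailEgf, coeff_one, hpos]
      | succ d => rfl

theorem eulerianPoly_insert {A : Finset α} {a : α} (ha : ∀ x ∈ A, x < a) :
    eulerianPoly (insert a A) = ∑ B ∈ A.powerset, tailPoly B * eulerianPoly (A \ B) := by
  have haA : a ∉ A := fun h => lt_irrefl a (ha a h)
  rw [eulerianPoly, sum_arrangements_insert haA]
  refine Finset.sum_nbij' (fun B => A \ B) (fun B => A \ B) (by simp) (by simp) ?_ ?_ ?_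
  · intro B hB
    exact Finset.sdiff_sdiff_eq_self (Finset.mem_powerset.1 hB)
  · intro B hB
    exact Finset.sdiff_sdiff_eq_self (Finset.mem_powerset.1 hB)
  intro B hB
  rw [Finset.mem_powerset] at hB
  rw [Finset.sdiff_sdiff_eq_self hB, mul_comm, eulerianPoly, Finset.sum_mul]
  refine Finset.sum_congr rfl fun l₁ h₁ => ?_
  rw [mem_arrangements] at h₁
  rw [tailPoly]
  split_ifs with h
  · rw [h, arrangements_empty, Finset.sum_singleton,
      des_append_cons_of_lt _ _ _ (fun x hx => ha x (hB ((h₁.2 x).1 hx))) (by simp)]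
    simp
  · rw [eulerianPoly, Finset.mul_sum, Finset.mul_sum]
    refine Finset.sum_congr rfl fun l₂ h₂ => ?_
    have hne : l₂ ≠ [] := by
      rintro rfl
      have := length_of_mem_arrangements h₂
      simp only [List.length_nil] at this
      exact h (Finset.card_eq_zero.1 this.symm)
    rw [mem_arrangements] at h₂
    rw [des_append_cons_of_lt _ _ _ (fun x hx => ha x (hB ((h₁.2 x).1 hx)))
      (fun x hx => ha x (Finset.mem_sdiff.1 ((h₂.2 x).1 hx)).1), if_neg hne]
    ring

theorem hasEgf_eulerianPoly (A : Finset α) : HasEgf A eulerianPoly eulerianEgf := by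
  refine hasEgf_of_insert (g := tailPoly) (G := tailEgf) (fun d hd => ?_)
    (fun A a ha h => ⟨h.tailPoly, eulerianPoly_insert ha⟩)
    (fun d hd => derivative_eulerianEgf hd) A
  rw [eulerianPoly_empty]
  interval_cases d <;> simp [eulerianEgf, Polynomial.coeff_one]

end Eulerian

section CycleDecomposition

open Equiv.Perm

variable {α : Type*} [Fintype α] [DecidableEq α]

theorem toList_tail_formPerm_cons {a : α} {l : List α} (h : (a :: l).Nodup) :
    ((a :: l).formPerm.toList a).tail = l := by
  cases l with
  | nil => simp
  | cons b l =>
    have := toList_formPerm_nontrivial (a :: b :: l) (by simp) h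
    simp only [List.get_eq_getElem, List.getElem_cons_zero] at this
    rw [this, List.tail_cons]

theorem cycleOf_formPerm_cons {a : α} {l : List α} (h : (a :: l).Nodup) :
    (a :: l).formPerm.cycleOf a = (a :: l).formPerm := by
  cases l with
  | nil =>
    rw [List.formPerm_singleton]
    exact (cycleOf_eq_one_iff _).2 rfl
  | cons b l => exact (List.isCycle_formPerm h (by simp)).cycleOf_eq (by
      rw [List.formPerm_apply_head a b l h]
      rintro rfl
      simp at h)

theorem toList_eq_cons_tail {π : Equiv.Perm α} {a : α} (ha : a ∈ π.support) :
    π.toList a = a :: (π.toList a).tail := by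
  have h0 := toList_getElem_zero (p := π) (x := a) ha
  rw [List.getElem_zero] at h0
  have := List.cons_head_tail
    (List.ne_nil_of_length_pos (length_toList_pos_of_mem_support (p := π) (x := a) ha))
  rw [h0] at this
  exact this.symm

theorem formPerm_cons_toList_tail (π : Equiv.Perm α) (a : α) :
    (a :: (π.toList a).tail).formPerm = π.cycleOf a := by
  by_cases ha : a ∈ π.support
  · rw [← formPerm_toList, ← toList_eq_cons_tail ha]
  · rw [toList_eq_nil_iff.2 ha, List.tail_nil, List.formPerm_singleton,
      cycleOf_eq_one_iff _ |>.2 (notMem_support.1 ha)]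

theorem disjoint_formPerm_cons {A B : Finset α} {a : α} {l : List α} {σ : Equiv.Perm α}
    (ha : a ∉ A) (hl : l ∈ arrangements B) (hσ : σ.support ⊆ A \ B) :
    Disjoint (a :: l).formPerm σ := by
  rw [disjoint_iff_disjoint_support, Finset.disjoint_left]
  intro x hx hx'
  have hx := List.support_formPerm_le (a :: l) hx
  have hx' := Finset.mem_sdiff.1 (hσ hx')
  rw [List.mem_toFinset, List.mem_cons, (mem_arrangements.1 hl).2] at hx
  rcases hx with rfl | hx
  · exact ha hx'.1
  · exact hx'.2 hx

/-- Splitting off the cycle of `a` from the permutations supported on `insert a A`. -/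
theorem sum_perm_support_subset_insert {R : Type*} [AddCommMonoid R] {A : Finset α} {a : α}
    (ha : a ∉ A) (F : Equiv.Perm α → R) :
    ∑ π : Equiv.Perm α with π.support ⊆ insert a A, F π =
      ∑ B ∈ A.powerset, ∑ l ∈ arrangements B,
        ∑ σ : Equiv.Perm α with σ.support ⊆ A \ B, F ((a :: l).formPerm * σ) := by
  simp_rw [← Finset.sum_product']
  rw [Finset.sum_sigma']
  symm
  refine Finset.sum_bij (fun x _ => (a :: x.2.1).formPerm * x.2.2) ?_ ?_ ?_ ?_
  · rintro ⟨B, l, σ⟩ h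
    simp only [Finset.mem_sigma, Finset.mem_powerset, Finset.mem_product,
      mem_arrangements, Finset.mem_filter, Finset.mem_univ, true_and] at h ⊢
    obtain ⟨hB, ⟨h1, h1'⟩, h2⟩ := h
    refine (support_mul_le _ _).trans (Finset.union_subset ?_ ?_)
    · refine (List.support_formPerm_le (a :: l)).trans fun x hx => ?_
      rw [List.mem_toFinset, List.mem_cons, h1'] at hx
      exact Finset.mem_insert.2 (hx.imp_right fun h => hB h)
    · exact h2.trans (Finset.sdiff_subset.trans (Finset.subset_insert _ _))
  · have key : ∀ x ∈ (A.powerset.sigma fun B => arrangements B ×ˢ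
        ({σ : Equiv.Perm α | σ.support ⊆ A \ B} : Finset (Equiv.Perm α))),
        ((a :: x.2.1).formPerm * x.2.2).cycleOf a = (a :: x.2.1).formPerm ∧
          (((a :: x.2.1).formPerm).toList a).tail = x.2.1 ∧ x.2.1.toFinset = x.1 := by
      rintro ⟨B, l, σ⟩ h
      simp only [Finset.mem_sigma, Finset.mem_powerset, Finset.mem_product,
        mem_arrangements, Finset.mem_filter, Finset.mem_univ, true_and] at h ⊢
      obtain ⟨hB, ⟨h1, h1'⟩, h2⟩ := h
      have hal : (a :: l).Nodup := List.nodup_cons.2 ⟨fun h => ha (hB ((h1' a).1 h)), h1⟩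
      have hdis := disjoint_formPerm_cons ha (mem_arrangements.2 ⟨h1, h1'⟩) h2
      refine ⟨?_, toList_tail_formPerm_cons hal, by ext x; simp [h1']⟩
      rw [hdis.cycleOf_mul_distrib, cycleOf_formPerm_cons hal]
      have : σ a = a := by
        by_contra h
        exact ha (Finset.mem_sdiff.1 (h2 (mem_support.2 h))).1
      rw [(cycleOf_eq_one_iff _).2 this, mul_one]
    intro x hx y hy heq
    obtain ⟨hx1, hx2, hx3⟩ := key x hx
    obtain ⟨hy1, hy2, hy3⟩ := key y hy
    obtain ⟨B, l, σ⟩ := x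
    obtain ⟨B', l', σ'⟩ := y
    simp only at heq hx1 hx2 hx3 hy1 hy2 hy3
    have hc : (a :: l).formPerm = (a :: l').formPerm := by rw [← hx1, ← hy1, heq]
    have hl : l = l' := by rw [← hx2, ← hy2, hc]
    subst hl
    have hB : B = B' := by rw [← hx3, ← hy3]
    subst hB
    rw [mul_left_cancel heq]
  · intro π hπ
    simp only [Finset.mem_filter, Finset.mem_univ, true_and] at hπ
    have hnd := nodup_toList π a
    have hmem : ∀ x, x ∈ (π.toList a).tail ↔ x ≠ a ∧ π.SameCycle a x := by
      intro x
      by_cases has : a ∈ π.support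
      · have hm := mem_toList_iff (p := π) (x := a) (y := x)
        have hnd' := hnd
        rw [toList_eq_cons_tail has, List.nodup_cons] at hnd'
        rw [toList_eq_cons_tail has] at hm
        simp only [List.mem_cons, has, and_true] at hm
        rw [← hm]
        constructor
        · intro hx
          exact ⟨fun h => hnd'.1 (h ▸ hx), Or.inr hx⟩
        · rintro ⟨h1, h2⟩
          exact h2.resolve_left h1
      · rw [toList_eq_nil_iff.2 has]
        simp only [List.tail_nil, List.not_mem_nil, false_iff, not_and]
        rintro hx ⟨k, hk⟩
        apply hx
        rw [← hk, zpow_apply_eq_self_of_apply_eq_self (notMem_support.1 has)]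
    refine ⟨⟨(π.toList a).tail.toFinset, (π.toList a).tail, (π.cycleOf a)⁻¹ * π⟩, ?_, ?_⟩
    · simp only [Finset.mem_sigma, Finset.mem_powerset, Finset.mem_product, mem_arrangements,
        Finset.mem_filter, Finset.mem_univ, true_and]
      refine ⟨fun x hx => ?_, ⟨hnd.tail, fun x => by simp⟩, fun x hx => ?_⟩
      · rw [List.mem_toFinset, hmem] at hx
        have hxs : x ∈ π.support := by
          rw [mem_support]
          intro h
          exact hx.1 (hx.2.symm.eq_of_left h)
        exact (Finset.mem_insert.1 (hπ hxs)).resolve_left hx.1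
      · rw [mem_support, Equiv.Perm.mul_apply, Ne, inv_eq_iff_eq, cycleOf_apply] at hx
        split_ifs at hx with hs
        · exact absurd rfl hx
        · have hxa : x ≠ a := by
            rintro rfl
            exact hs (SameCycle.refl _ _)
          have hxs : x ∈ π.support := mem_support.2 hx
          refine Finset.mem_sdiff.2
            ⟨(Finset.mem_insert.1 (hπ hxs)).resolve_left hxa, fun h => ?_⟩
          rw [List.mem_toFinset, hmem] at h
          exact hs h.2
    · simp only [formPerm_cons_toList_tail, mul_inv_cancel_left]
  · intro x _
    rfl

end CycleDecomposition

section OddOrder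

open Equiv.Perm

theorem descentWord_cons_append_singleton {α : Type*} [LinearOrder α] : ∀ (l : List α) (a z : α),
    descentWord (a :: (l ++ [z])) =
      List.zipWith (fun x y => decide (y < x)) (a :: l) (l ++ [z])
  | [], _, _ => rfl
  | b :: l, _, z => by
    have := descentWord_cons_append_singleton l b z
    simp [descentWord, this]

theorem map_formPerm_cons {α : Type*} [DecidableEq α] {a : α} {l : List α}
    (h : (a :: l).Nodup) : (a :: l).map (a :: l).formPerm = l ++ [a] := by
  have : l ++ [a] = (a :: l).rotate 1 := by simp
  rw [this]
  refine List.ext_getElem (by simp) fun i h1 h2 => ?_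
  rw [List.getElem_map, List.formPerm_apply_getElem _ h, List.getElem_rotate]

variable {n : ℕ}

theorem support_formPerm_cons {a : Fin n} {l : List (Fin n)} (h : (a :: l).Nodup) (hl : l ≠ []) :
    (a :: l).formPerm.support = (a :: l).toFinset :=
  List.support_formPerm_of_nodup _ h (by simp [hl])

/-- The cyclic descents of a cycle, written from its maximal element on. -/
theorem card_filter_formPerm_lt {a : Fin n} {l : List (Fin n)} (h : (a :: l).Nodup) (hl : l ≠ [])
    (ha : ∀ x ∈ l, x < a) :
    ((a :: l).formPerm.support.filter fun x => (a :: l).formPerm x < x).card = 1 + des l := by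
  have h1 : descentWord (a :: (l ++ [a])) =
      (a :: l).map fun x => decide ((a :: l).formPerm x < x) := by
    rw [descentWord_cons_append_singleton, ← map_formPerm_cons h, List.zipWith_map_right,
      List.zipWith_self]
  have h2 : (descentWord (a :: (l ++ [a]))).count true = 1 + des l := by
    rw [← des_append_singleton l a ha]
    obtain ⟨b, l', rfl⟩ := List.exists_cons_of_ne_nil hl
    have : b < a := ha b (by simp)
    simp [des, descentWord, this, add_comm]
  have h3 : (a :: l).toFinset.filter (fun x => (a :: l).formPerm x < x) =
      ((a :: l).filter fun x => decide ((a :: l).formPerm x < x)).toFinset := by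
    ext x
    simp only [Finset.mem_filter, List.mem_toFinset, List.mem_filter, decide_eq_true_eq]
  rw [support_formPerm_cons h hl, h3,
    List.toFinset_card_of_nodup (h.filter _), ← List.countP_eq_length_filter, ← h2, h1,
    List.count, List.countP_map]
  congr 1
  ext x
  simp

theorem card_filter_lt_formPerm {a : Fin n} {l : List (Fin n)} (h : (a :: l).Nodup) (hl : l ≠ [])
    (ha : ∀ x ∈ l, x < a) :
    ((a :: l).formPerm.support.filter fun x => x < (a :: l).formPerm x).card =
      l.length - des l := by
  have h1 := card_filter_formPerm_lt h hl ha
  have h2 := Finset.card_filter_add_card_filter_not (s := (a :: l).formPerm.support)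
    (fun x => (a :: l).formPerm x < x)
  have h3 : ((a :: l).formPerm.support.filter fun x => x < (a :: l).formPerm x) =
      (a :: l).formPerm.support.filter fun x => ¬ (a :: l).formPerm x < x := by
    refine Finset.filter_congr fun x hx => ?_
    rw [mem_support] at hx
    rw [not_lt, lt_iff_le_and_ne]
    exact and_iff_left hx.symm
  have h4 : (a :: l).formPerm.support.card = l.length + 1 := by
    rw [support_formPerm_cons h hl, List.toFinset_card_of_nodup h, List.length_cons]
  rw [h3]
  omega

/-- The statistic `M` of the cycle consisting of a maximal element followed by `l`. -/
def cycleMin (l : List (Fin n)) : ℕ := if l = [] then 0 else min (1 + des l) (l.length - des l)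

theorem permM_formPerm_cons {a : Fin n} {l : List (Fin n)} (h : (a :: l).Nodup)
    (ha : ∀ x ∈ l, x < a) : permM (a :: l).formPerm = cycleMin l := by
  rw [cycleMin]
  split_ifs with hl
  · subst hl
    simp [permM]
  · have hc : (a :: l).formPerm.IsCycle :=
      List.isCycle_formPerm h (Nat.succ_le_succ (List.length_pos_of_ne_nil hl))
    rw [permM, hc.cycleFactorsFinset_eq_singleton, Finset.sum_singleton, cycleM, min_comm]
    convert congrArg₂ min (card_filter_formPerm_lt h hl ha) (card_filter_lt_formPerm h hl ha)

theorem orderOf_formPerm_cons {a : Fin n} {l : List (Fin n)} (h : (a :: l).Nodup) :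
    orderOf (a :: l).formPerm = l.length + 1 := by
  by_cases hl : l = []
  · subst hl
    simp
  · have hc : (a :: l).formPerm.IsCycle :=
      List.isCycle_formPerm h (Nat.succ_le_succ (List.length_pos_of_ne_nil hl))
    rw [hc.orderOf, support_formPerm_cons h hl, List.toFinset_card_of_nodup h, List.length_cons]

/-- The weight of a permutation in the enumeration of odd order permutations by `M`. -/
noncomputable def oddWeight (π : Equiv.Perm (Fin n)) : Polynomial ℚ :=
  if Odd (orderOf π) then Polynomial.X ^ permM π else 0

theorem oddWeight_mul {σ τ : Equiv.Perm (Fin n)} (h : Disjoint σ τ) :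
    oddWeight (σ * τ) = oddWeight σ * oddWeight τ := by
  have h1 : permM (σ * τ) = permM σ + permM τ := by
    rw [permM, h.cycleFactorsFinset_mul_eq_union,
      Finset.sum_union h.disjoint_cycleFactorsFinset, permM, permM]
  have h2 : Odd (orderOf (σ * τ)) ↔ Odd (orderOf σ) ∧ Odd (orderOf τ) := by
    rw [h.orderOf, ← Nat.not_even_iff_odd, ← Nat.not_even_iff_odd, ← Nat.not_even_iff_odd,
      even_iff_two_dvd, even_iff_two_dvd, even_iff_two_dvd, Nat.prime_two.dvd_lcm, not_or]
  simp only [oddWeight, h1, h2, pow_add]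
  split_ifs <;> simp_all

/-- The enumerator by `M` of the odd order permutations supported on `A`. -/
noncomputable def oddPoly (A : Finset (Fin n)) : Polynomial ℚ :=
  ∑ π : Equiv.Perm (Fin n) with π.support ⊆ A, oddWeight π

/-- The enumerator by `M` of the cycles of odd length on a set obtained from `B` by adjoining a
maximal element. -/
noncomputable def cyclePoly (B : Finset (Fin n)) : Polynomial ℚ :=
  if Even B.card then ∑ l ∈ arrangements B, Polynomial.X ^ cycleMin l else 0

theorem oddPoly_insert {A : Finset (Fin n)} {a : Fin n} (ha : ∀ x ∈ A, x < a) :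
    oddPoly (insert a A) = ∑ B ∈ A.powerset, cyclePoly B * oddPoly (A \ B) := by
  have haA : a ∉ A := fun h => lt_irrefl a (ha a h)
  rw [oddPoly, sum_perm_support_subset_insert haA]
  refine Finset.sum_congr rfl fun B hB => ?_
  rw [Finset.mem_powerset] at hB
  have hcycle : cyclePoly B = ∑ l ∈ arrangements B, oddWeight (a :: l).formPerm := by
    have hw : ∀ l ∈ arrangements B, oddWeight (a :: l).formPerm =
        if Even B.card then Polynomial.X ^ cycleMin l else 0 := by
      intro l hl
      have hlen := length_of_mem_arrangements hl
      rw [mem_arrangements] at hl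
      have hlt : ∀ x ∈ l, x < a := fun x hx => ha x (hB ((hl.2 x).1 hx))
      have hnd : (a :: l).Nodup := List.nodup_cons.2 ⟨fun h => lt_irrefl a (hlt a h), hl.1⟩
      rw [oddWeight, orderOf_formPerm_cons hnd, permM_formPerm_cons hnd hlt, hlen]
      simp only [Nat.odd_add_one, Nat.not_odd_iff_even]
    rw [Finset.sum_congr rfl hw, cyclePoly]
    split_ifs <;> simp
  rw [hcycle, oddPoly, Finset.sum_mul]
  refine Finset.sum_congr rfl fun l hl => ?_
  rw [Finset.mul_sum]
  refine Finset.sum_congr rfl fun σ hσ => oddWeight_mul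
    (disjoint_formPerm_cons haA hl (Finset.mem_filter.1 hσ).2)

theorem oddPoly_empty : oddPoly (∅ : Finset (Fin n)) = 1 := by
  simp [oddPoly, oddWeight, permM, Finset.filter_eq']

theorem coeff_oddPoly_univ (d : ℕ) :
    (oddPoly (Finset.univ : Finset (Fin n))).coeff d = pCount n d := by
  simp only [oddPoly, oddWeight, Finset.subset_univ, Finset.filter_true,
    Polynomial.finsetSum_coeff, pCount, Finset.card_filter, Nat.cast_sum]
  refine Finset.sum_congr rfl fun π _ => ?_
  by_cases h : Odd (orderOf π) <;> simp [h, Polynomial.coeff_X_pow, eq_comm]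

end OddOrder

section ClosedForms

open PowerSeries

theorem factorial_mul_coeff_eulerianEgf_zero (n : ℕ) :
    (n.factorial : ℚ) * coeff n (eulerianEgf 0) = 1 := by
  have := factorial_mul_coeff_X_pow_mul_exp_pow 0 1 n
  simpa [eulerianEgf] using this

theorem factorial_mul_coeff_eulerianEgf_one (n : ℕ) :
    (n.factorial : ℚ) * coeff n (eulerianEgf 1) = 2 ^ n - n - 1 := by
  have h : eulerianEgf 1 = X ^ 0 * exp ℚ ^ 2 - X ^ 0 * exp ℚ ^ 1 - X ^ 1 * exp ℚ ^ 1 := by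
    rw [eulerianEgf]; ring
  rw [h, map_sub, map_sub, mul_sub, mul_sub]
  simp only [factorial_mul_coeff_X_pow_mul_exp_pow]
  simp
  ring

theorem factorial_mul_coeff_eulerianEgf_two (n : ℕ) :
    (n.factorial : ℚ) * coeff n (eulerianEgf 2) =
      3 ^ n - (n + 1) * 2 ^ n + n * (n + 1) / 2 := by
  have h : eulerianEgf 2 = X ^ 0 * exp ℚ ^ 3 - X ^ 0 * exp ℚ ^ 2 - C 2 * (X ^ 1 * exp ℚ ^ 2)
      + X ^ 1 * exp ℚ ^ 1 + C (1 / 2) * (X ^ 2 * exp ℚ ^ 1) := by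
    rw [eulerianEgf, map_ofNat C 2]; ring
  rw [h]
  simp only [map_add, map_sub, mul_add, mul_sub, coeff_C_mul,
    mul_left_comm (n.factorial : ℚ), factorial_mul_coeff_X_pow_mul_exp_pow]
  rcases n with _ | _ | n
  · norm_num
  · norm_num
  · simp [Nat.descFactorial_succ]
    ring

theorem factorial_mul_coeff_eulerianEgf_three (n : ℕ) :
    (n.factorial : ℚ) * coeff n (eulerianEgf 3) =
      4 ^ n - (n + 1) * 3 ^ n + n * (n + 1) / 2 * 2 ^ n - (n - 1) * n * (n + 1) / 6 := by
  have h : eulerianEgf 3 = X ^ 0 * exp ℚ ^ 4 - X ^ 0 * exp ℚ ^ 3 - C 3 * (X ^ 1 * exp ℚ ^ 3)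
      + C 2 * (X ^ 1 * exp ℚ ^ 2) + C 2 * (X ^ 2 * exp ℚ ^ 2) - C (1 / 2) * (X ^ 2 * exp ℚ ^ 1)
      - C (1 / 6) * (X ^ 3 * exp ℚ ^ 1) := by
    rw [eulerianEgf, map_ofNat C 2, map_ofNat C 3]; ring
  rw [h]
  simp only [map_add, map_sub, mul_add, mul_sub, coeff_C_mul,
    mul_left_comm (n.factorial : ℚ), factorial_mul_coeff_X_pow_mul_exp_pow]
  rcases n with _ | _ | _ | n
  · norm_num
  · norm_num
  · norm_num [Nat.descFactorial_succ]
  · simp [Nat.descFactorial_succ]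
    ring

/-- The derivatives of the exponential generating functions of the cycles of odd length by the
statistic `M`. -/
noncomputable def cycleEgf : ℕ → ℚ⟦X⟧
  | 0 => 1
  | 1 => eulerianEgf 0 + evalNegHom (eulerianEgf 0) - C 2
  | 2 => eulerianEgf 1 + evalNegHom (eulerianEgf 1) - X ^ 2
  | 3 => eulerianEgf 2 + evalNegHom (eulerianEgf 2) - C (11 / 12) * X ^ 4
  | _ => 0

/-- The exponential generating functions of the odd order permutations by the statistic `M`. -/
noncomputable def oddEgf : ℕ → ℚ⟦X⟧
  | 0 => exp ℚ
  | 1 => exp ℚ ^ 2 - 1 - 2 * X * exp ℚ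
  | 2 => exp ℚ ^ 3 - exp ℚ + X - 3 * X * exp ℚ ^ 2 + 2 * X ^ 2 * exp ℚ - C (1 / 3) * X ^ 3 * exp ℚ
  | 3 => exp ℚ ^ 4 - exp ℚ ^ 2 + 2 * X * exp ℚ - 4 * X * exp ℚ ^ 3 - C (1 / 2) * X ^ 2
      + C (9 / 2) * X ^ 2 * exp ℚ ^ 2 + C (1 / 3) * X ^ 3 - C (4 / 3) * X ^ 3 * exp ℚ
      - C (1 / 3) * X ^ 3 * exp ℚ ^ 2 + C (2 / 3) * X ^ 4 * exp ℚ - C (11 / 60) * X ^ 5 * exp ℚ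
  | _ => 0

theorem derivative_oddEgf {d : ℕ} (hd : d ≤ 3) :
    derivative ℚ (oddEgf d) = ∑ ij ∈ antidiagonal d, cycleEgf ij.1 * oddEgf ij.2 := by
  have hC (q : ℚ) : derivative ℚ (C q) = 0 := derivative_C
  have hn (n : ℕ) [n.AtLeastTwo] : derivative ℚ (OfNat.ofNat n : ℚ⟦X⟧) = 0 :=
    Derivation.map_natCast _ n
  obtain ⟨c, hc⟩ : ∃ c : ℚ⟦X⟧, c = C (1 / 60) := ⟨_, rfl⟩
  have h60 : 60 * c = 1 := by
    rw [hc, ← map_ofNat C 60, ← map_mul]; norm_num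
  have hq (k : ℕ) (q : ℚ) (h : k / 60 = q := by norm_num) : (C q : ℚ⟦X⟧) = k * c := by
    rw [hc, ← h, ← map_natCast C k, ← map_mul]
    congr 1
    ring
  have h12 := hq 30 (1 / 2)
  have h13 := hq 20 (1 / 3)
  have h43 := hq 80 (4 / 3)
  have h23 := hq 40 (2 / 3)
  have h92 := hq 270 (9 / 2)
  have h1160 := hq 11 (11 / 60)
  have h1112 := hq 55 (11 / 12)
  have hX : evalNegHom (X : ℚ⟦X⟧) = -X := by
    simp [evalNegHom]
  have hCn (q : ℚ) : evalNegHom (C q : ℚ⟦X⟧) = C q := by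
    ext n
    rcases eq_or_ne n 0 with rfl | h
    · simp [evalNegHom]
    · simp [evalNegHom, coeff_rescale, coeff_C, h]
  obtain ⟨u, hu⟩ : ∃ u : ℚ⟦X⟧, evalNegHom (exp ℚ) = u := ⟨_, rfl⟩
  have heu : exp ℚ * u = 1 := by rw [← hu, exp_mul_exp_neg_eq_one]
  interval_cases d <;>
    simp only [Finset.Nat.antidiagonal_succ, Finset.Nat.antidiagonal_zero, eulerianEgf, cycleEgf,
      oddEgf, Finset.sum_cons, Finset.sum_singleton, Finset.map_singleton,
      Finset.map_cons, map_add, map_sub, map_mul, map_pow, map_ofNat, Derivation.leibniz,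
      Derivation.leibniz_pow, Derivation.map_one_eq_zero,
      derivative_exp, derivative_X, smul_eq_mul, nsmul_eq_mul, hC, hn,
      Function.Embedding.coeFn_mk, Function.Embedding.prodMap, Prod.map,
      Function.Embedding.refl_apply, Nat.succ_eq_add_one, hX, hCn, hu] <;>
    try simp only [h12, h13, h43, h23, h92, h1160, h1112]
  · ring
  · linear_combination -heu
  · push_cast
    linear_combination (1 + X - u - exp ℚ) * heu - exp ℚ * X ^ 2 * h60
  · push_cast
    linear_combination (exp ℚ + u - X - exp ℚ ^ 2 - exp ℚ * u - u ^ 2 + 2 * exp ℚ * X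
      + 20 * c * X ^ 3 - 30 * c * X ^ 2) * heu + (3 * exp ℚ ^ 2 * X ^ 2 + 9 * exp ℚ ^ 2 * X
      + 2 * exp ℚ * X ^ 3 - 4 * exp ℚ * X ^ 2 + X ^ 2 - X) * h60

end ClosedForms

section OddOrderEgf

open PowerSeries

variable {n : ℕ}

theorem card_filter_des_reverse (B : Finset (Fin n)) {d : ℕ} (hd : d + 1 ≤ B.card) :
    ((arrangements B).filter fun l => des l = B.card - 1 - d).card =
      ((arrangements B).filter fun l => des l = d).card := by
  have hrev {l : List (Fin n)} (hl : l ∈ arrangements B) : l.reverse ∈ arrangements B := by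
    simpa [mem_arrangements] using hl
  have key {l : List (Fin n)} (hl : l ∈ arrangements B) :
      des l.reverse + des l = B.card - 1 := by
    rw [des_reverse_add_des (mem_arrangements.1 hl).1, length_of_mem_arrangements hl]
  refine Finset.card_nbij' List.reverse List.reverse ?_ ?_
    (fun l _ => l.reverse_reverse) (fun l _ => l.reverse_reverse)
  all_goals
    intro l hl
    simp only [Finset.coe_filter, Set.mem_ofPred_eq] at hl ⊢
    have := key hl.1
    exact ⟨hrev hl.1, by omega⟩

theorem card_filter_cycleMin (B : Finset (Fin n)) {d : ℕ} (hd : 2 * (d + 1) ≤ B.card) :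
    ((arrangements B).filter fun l => cycleMin l = d + 1).card =
      2 * ((arrangements B).filter fun l => des l = d).card := by
  rw [two_mul]
  nth_rewrite 1 [← card_filter_des_reverse B (by omega)]
  rw [← Finset.card_union_of_disjoint, ← Finset.filter_or]
  · congr 1
    refine Finset.filter_congr fun l hl => ?_
    have hlen := length_of_mem_arrangements hl
    have hle := des_le l
    have hne : l ≠ [] := by rintro rfl; simp at hlen; omega
    rw [cycleMin, if_neg hne]
    omega
  · rw [Finset.disjoint_filter]
    omega

theorem filter_cycleMin_eq_empty (B : Finset (Fin n)) {d : ℕ} (hB : Even B.card)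
    (hd : B.card < 2 * d) :
    ((arrangements B).filter fun l => cycleMin l = d) = ∅ := by
  rw [Finset.filter_eq_empty_iff]
  intro l hl
  have hlen := length_of_mem_arrangements hl
  obtain ⟨k, hk⟩ := hB
  rw [cycleMin]
  split_ifs <;> omega

theorem filter_cycleMin_eq_zero {B : Finset (Fin n)} (hB : B.card ≠ 0) :
    ((arrangements B).filter fun l => cycleMin l = 0) = ∅ := by
  rw [Finset.filter_eq_empty_iff]
  intro l hl
  have hlen := length_of_mem_arrangements hl
  have hle := des_le l
  have hne : l ≠ [] := by rintro rfl; simp at hlen; omega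
  rw [cycleMin, if_neg hne]
  omega

theorem coeff_evalNegHom (F : ℚ⟦X⟧) (m : ℕ) : coeff m (evalNegHom F) = (-1) ^ m * coeff m F :=
  coeff_rescale _ _ _

theorem coeff_cycleEgf_of_odd {m d : ℕ} (hm : Odd m) : coeff m (cycleEgf d) = 0 := by
  have h0 : m ≠ 0 := by rintro rfl; exact absurd hm (by decide)
  have h2 : m ≠ 2 := by rintro rfl; exact absurd hm (by decide)
  have h4 : m ≠ 4 := by rintro rfl; exact absurd hm (by decide)
  unfold cycleEgf
  split <;> simp [coeff_evalNegHom, hm.neg_one_pow, coeff_C, coeff_X_pow, coeff_one, h0, h2, h4]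

theorem coeff_cyclePoly {B : Finset (Fin n)} (hB : Even B.card) (d : ℕ) :
    (cyclePoly B).coeff d = ((arrangements B).filter fun l => cycleMin l = d).card := by
  simp [cyclePoly, hB, Polynomial.coeff_X_pow, eq_comm]

theorem hasEgf_cyclePoly (A : Finset (Fin n)) : HasEgf A cyclePoly cycleEgf := by
  intro B _ d hd
  rcases Nat.even_or_odd B.card with hB | hB
  swap
  · rw [coeff_cycleEgf_of_odd hB]
    simp [cyclePoly, Nat.not_even_iff_odd.2 hB]
  rw [coeff_cyclePoly hB]
  have hE (d : ℕ) (hd : d ≤ 3) := hasEgf_eulerianPoly B B subset_rfl d hd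
  simp only [coeff_eulerianPoly] at hE
  have h1 := hE 1 (by norm_num)
  have h2 := hE 2 (by norm_num)
  rcases Nat.eq_zero_or_pos d with rfl | hd0
  · by_cases h0 : B.card = 0
    · rw [Finset.card_eq_zero] at h0
      subst h0
      simp [arrangements_empty, cycleMin, cycleEgf, Finset.filter_singleton]
    · rw [filter_cycleMin_eq_zero h0]
      simp [cycleEgf, coeff_one, h0]
  rcases lt_or_ge B.card (2 * d) with hlt | hge
  · rw [filter_cycleMin_eq_empty B hB hlt]
    have e0 := factorial_mul_coeff_eulerianEgf_zero B.card
    have e1 := factorial_mul_coeff_eulerianEgf_one B.card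
    have e2 := factorial_mul_coeff_eulerianEgf_two B.card
    generalize B.card = m at *
    obtain ⟨k, rfl⟩ := hB
    have hk : k ≤ 2 := by omega
    interval_cases d <;> interval_cases k <;> simp at hlt <;>
      simp only [cycleEgf, map_add, map_sub, coeff_evalNegHom, coeff_C_mul, coeff_C,
        coeff_X_pow, Nat.factorial] at * <;> norm_num at * <;> linarith
  · obtain ⟨d, rfl⟩ : ∃ e, d = e + 1 := ⟨d - 1, by omega⟩
    rw [card_filter_cycleMin B hge]
    push_cast
    rw [hE d (by omega)]
    have hc : coeff B.card (cycleEgf (d + 1)) = 2 * coeff B.card (eulerianEgf d) := by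
      have hd3 : d ≤ 2 := by omega
      interval_cases d <;>
        simp only [cycleEgf, map_add, map_sub, coeff_evalNegHom, hB.neg_one_pow, coeff_C_mul,
          coeff_C, coeff_X_pow]
      all_goals
        rw [if_neg (by omega)]
        ring
    rw [hc]
    ring

theorem hasEgf_oddPoly (A : Finset (Fin n)) : HasEgf A oddPoly oddEgf := by
  refine hasEgf_of_insert (g := cyclePoly) (G := cycleEgf) (fun d hd => ?_)
    (fun A a ha h => ⟨hasEgf_cyclePoly A, oddPoly_insert ha⟩)
    (fun d hd => derivative_oddEgf hd) A
  rw [oddPoly_empty]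
  interval_cases d <;> simp [oddEgf, Polynomial.coeff_one]

theorem pCount_three (n : ℕ) (hn : 4 ≤ n) : (pCount n 3 : ℚ) =
    4 ^ n - 2 ^ n + 2 * n - 4 * n * 3 ^ (n - 1) + 9 / 2 * n.descFactorial 2 * 2 ^ (n - 2)
      - 4 / 3 * n.descFactorial 3 - 1 / 3 * n.descFactorial 3 * 2 ^ (n - 3)
      + 2 / 3 * n.descFactorial 4 - 11 / 60 * n.descFactorial 5 := by
  rw [← coeff_oddPoly_univ, hasEgf_oddPoly univ univ subset_rfl 3 le_rfl]
  simp only [Finset.card_univ, Fintype.card_fin]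
  have h : oddEgf 3 = X ^ 0 * exp ℚ ^ 4 - X ^ 0 * exp ℚ ^ 2 + C 2 * (X ^ 1 * exp ℚ ^ 1)
      - C 4 * (X ^ 1 * exp ℚ ^ 3) - C (1 / 2) * (X ^ 2 * exp ℚ ^ 0)
      + C (9 / 2) * (X ^ 2 * exp ℚ ^ 2) + C (1 / 3) * (X ^ 3 * exp ℚ ^ 0)
      - C (4 / 3) * (X ^ 3 * exp ℚ ^ 1) - C (1 / 3) * (X ^ 3 * exp ℚ ^ 2)
      + C (2 / 3) * (X ^ 4 * exp ℚ ^ 1) - C (11 / 60) * (X ^ 5 * exp ℚ ^ 1) := by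
    rw [oddEgf, map_ofNat C 2, map_ofNat C 4]; ring
  rw [h]
  simp only [map_add, map_sub, mul_add, mul_sub, coeff_C_mul,
    mul_left_comm (n.factorial : ℚ), factorial_mul_coeff_X_pow_mul_exp_pow]
  have e2 : n - 2 ≠ 0 := by omega
  have e3 : n - 3 ≠ 0 := by omega
  simp [e2, e3]
  ring

end OddOrderEgf
section Ballot

variable {α : Type*} [LinearOrder α]

/-- The number of arrangements of `A` with `e` descents whose descent word starts with `p`. -/
noncomputable def prefixCount (A : Finset α) (p : List Bool) (e : ℕ) : ℕ :=
  ((arrangements A).filter fun l => p <+: descentWord l ∧ des l = e).card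

theorem prefixCount_nil (A : Finset α) {d : ℕ} (hd : d ≤ 3) :
    (prefixCount A [] d : ℚ) = A.card.factorial * PowerSeries.coeff A.card (eulerianEgf d) := by
  rw [← hasEgf_eulerianPoly A A subset_rfl d hd, coeff_eulerianPoly, prefixCount]
  simp

theorem prefixCount_eq_zero (A : Finset α) {p : List Bool} {e : ℕ} (h : e < p.count true) :
    prefixCount A p e = 0 := by
  rw [prefixCount, Finset.card_eq_zero, Finset.filter_eq_empty_iff]
  rintro l - ⟨hp, he⟩
  have := hp.sublist.count_le true
  rw [des] at he
  omega

theorem prefixCount_append_singleton (A : Finset α) {p : List Bool} (e : ℕ)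
    (h : p.length + 1 < A.card) :
    prefixCount A p e = prefixCount A (p ++ [false]) e + prefixCount A (p ++ [true]) e := by
  simp only [prefixCount, Finset.card_filter, ← Finset.sum_add_distrib]
  refine Finset.sum_congr rfl fun l hl => ?_
  have hlen : p.length < (descentWord l).length := by
    rw [length_descentWord, length_of_mem_arrangements hl]
    omega
  by_cases hp : p <+: descentWord l
  · obtain ⟨_ | ⟨b, s⟩, hs⟩ := hp
    · simp [← hs] at hlen
    · rw [← hs]
      cases b <;> simp
  · have hb (b : Bool) : ¬ p ++ [b] <+: descentWord l :=
      fun h => hp ((List.prefix_append _ _).trans h)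
    simp [hp, hb]

theorem sum_arrangements_ite_descentWord {A : Finset α} {p : List Bool}
    (h : A.card = p.length + 1) :
    (∑ l ∈ arrangements A, if descentWord l = p then 1 else 0) =
      prefixCount A p (p.count true) := by
  rw [← Finset.card_filter, prefixCount]
  congr 1
  refine Finset.filter_congr fun l hl => ?_
  have hlen : p.length = (descentWord l).length := by
    rw [length_descentWord, length_of_mem_arrangements hl, h, Nat.add_sub_cancel]
  constructor
  · rintro rfl
    exact ⟨List.prefix_rfl, rfl⟩
  · exact fun h => (h.1.eq_of_length hlen).symm

/-- Cutting a word after the prefix `p`, where the letter of the descent word is free. -/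
theorem prefixCount_false_add_prefixCount_true (A : Finset α) {p : List Bool} {d m : ℕ}
    (h : p.length + 1 < A.card) (hd : d ≤ 3)
    (hm : ∀ B : Finset α, B.card = p.length + 1 → prefixCount B p (p.count true) = m) :
    (prefixCount A (p ++ [false]) (p.count true + d) : ℚ) +
        prefixCount A (p ++ [true]) (p.count true + d + 1) =
      A.card.choose (p.length + 1) * m * ((A.card - (p.length + 1)).factorial *
        PowerSeries.coeff (A.card - (p.length + 1)) (eulerianEgf d)) := by
  have hsum : prefixCount A (p ++ [false]) (p.count true + d) +
      prefixCount A (p ++ [true]) (p.count true + d + 1) =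
      ∑ l ∈ arrangements A, (if descentWord (l.take (p.length + 1)) = p then 1 else 0) *
        if des (l.drop (p.length + 1)) = d then 1 else 0 := by
    simp only [prefixCount, Finset.card_filter, ← Finset.sum_add_distrib]
    refine Finset.sum_congr rfl fun l hl => ?_
    have hlen : p.length < (descentWord l).length := by
      rw [length_descentWord, length_of_mem_arrangements hl]
      omega
    rw [descentWord_take, des, des, descentWord_drop]
    by_cases hp : p <+: descentWord l
    · obtain ⟨_ | ⟨b, s⟩, hs⟩ := hp
      · simp [← hs] at hlen
      · rw [← hs]
        have hdrop : p.drop (p.length + 1) = [] := List.drop_eq_nil_of_le (Nat.le_succ _)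
        cases b <;> simp [List.drop_append, hdrop, add_assoc]
    · have hb (b : Bool) : ¬ p ++ [b] <+: descentWord l :=
        fun h => hp ((List.prefix_append _ _).trans h)
      have ht : (descentWord l).take p.length ≠ p := fun h => hp (h ▸ List.take_prefix _ _)
      simp [ht, hb]
  rw [← Nat.cast_add, hsum,
    sum_arrangements_take_drop A h.le
      (fun l₁ l₂ => (if descentWord l₁ = p then 1 else 0) * if des l₂ = d then 1 else 0)]
  simp_rw [← Finset.mul_sum, ← Finset.sum_mul]
  push_cast
  rw [Finset.sum_congr rfl (g := fun _ => (m : ℚ) * ((A.card - (p.length + 1)).factorial *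
        PowerSeries.coeff (A.card - (p.length + 1)) (eulerianEgf d)))]
  · rw [Finset.sum_const, Finset.card_powersetCard, nsmul_eq_mul, mul_assoc]
  · intro B hB
    rw [Finset.mem_powersetCard] at hB
    have h1 := sum_arrangements_ite_descentWord hB.2
    rw [hm B hB.2] at h1
    have h2 := hasEgf_eulerianPoly (A \ B) _ subset_rfl d hd
    rw [coeff_eulerianPoly, Finset.card_filter, Finset.card_sdiff_of_subset hB.1, hB.2] at h2
    rw [← h2, ← h1]
    push_cast
    rfl

theorem prefixCount_zero_of_nil (A : Finset α) : prefixCount A [] 0 = 1 := by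
  have := prefixCount_nil A (d := 0) (by norm_num)
  rw [factorial_mul_coeff_eulerianEgf_zero] at this
  exact_mod_cast this

theorem prefixCount_append_false (A : Finset α) {p : List Bool}
    (h : p.length + 1 < A.card) :
    prefixCount A (p ++ [false]) (p.count true) = prefixCount A p (p.count true) := by
  rw [prefixCount_append_singleton A _ h, prefixCount_eq_zero A (p := p ++ [true]) (by simp),
    add_zero]

/-- The words all of whose descents belong to a prefix ending in a descent. -/
theorem prefixCount_append_true (A : Finset α) {p : List Bool} {m : ℕ}
    (h : p.length + 1 < A.card)
    (hm : ∀ B : Finset α, B.card = p.length + 1 → prefixCount B p (p.count true) = m) :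
    prefixCount A (p ++ [true]) (p.count true + 1) + prefixCount A p (p.count true) =
      A.card.choose (p.length + 1) * m := by
  have := prefixCount_false_add_prefixCount_true A (d := 0) h (by norm_num) hm
  rw [factorial_mul_coeff_eulerianEgf_zero, mul_one, add_zero, prefixCount_append_false A h] at this
  rw [add_comm]
  exact_mod_cast this

theorem prefixCount_U (A : Finset α) (h : 2 ≤ A.card) : prefixCount A [false] 0 = 1 := by
  rw [← prefixCount_zero_of_nil A]
  exact prefixCount_append_false A (p := []) h

theorem prefixCount_UU (A : Finset α) (h : 3 ≤ A.card) : prefixCount A [false, false] 0 = 1 := by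
  rw [← prefixCount_U A (by omega)]
  exact prefixCount_append_false A (p := [false]) h

theorem prefixCount_UD (A : Finset α) (h : 3 ≤ A.card) :
    prefixCount A [false, true] 1 + 1 = A.card.choose 2 := by
  have := prefixCount_append_true A (p := [false]) h
    (fun B hB => prefixCount_U B hB.ge)
  simpa [prefixCount_U A (by omega : 2 ≤ A.card)] using this

theorem prefixCount_UDU (A : Finset α) (h : 4 ≤ A.card) :
    prefixCount A [false, true, false] 1 + 1 = A.card.choose 2 := by
  rw [← prefixCount_UD A (by omega)]
  exact congrArg (· + 1) (prefixCount_append_false A (p := [false, true]) h)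

theorem prefixCount_UUD (A : Finset α) (h : 4 ≤ A.card) :
    prefixCount A [false, false, true] 1 + 1 = A.card.choose 3 := by
  have := prefixCount_append_true A (p := [false, false]) h
    (fun B hB => prefixCount_UU B hB.ge)
  simpa [prefixCount_UU A (by omega : 3 ≤ A.card)] using this

theorem prefixCount_UDUD (A : Finset α) (h : 5 ≤ A.card) :
    prefixCount A [false, true, false, true] 2 + A.card.choose 2 = A.card.choose 4 * 5 + 1 := by
  have h1 := prefixCount_append_true A (p := [false, true, false]) (m := 5) h
    (fun B hB => by
      have := prefixCount_UDU B hB.ge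
      rw [hB] at this
      simpa [Nat.choose] using this)
  have h2 := prefixCount_UDU A (by omega)
  simp at h1
  omega

theorem prefixCount_UUDD (A : Finset α) (h : 5 ≤ A.card) :
    prefixCount A [false, false, true, true] 2 + A.card.choose 3 = A.card.choose 4 * 3 + 1 := by
  have h1 := prefixCount_append_true A (p := [false, false, true]) (m := 3) h
    (fun B hB => by
      have := prefixCount_UUD B hB.ge
      rw [hB] at this
      simpa [Nat.choose] using this)
  have h2 := prefixCount_UUD A (by omega)
  simp at h1
  omega

theorem prefixCount_UDUDD (A : Finset α) (h : 6 ≤ A.card) :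
    prefixCount A [false, true, false, true, true] 3 + A.card.choose 4 * 5 + 1 =
      A.card.choose 5 * 16 + A.card.choose 2 := by
  have h1 := prefixCount_append_true A (p := [false, true, false, true]) (m := 16) h
    (fun B hB => by
      have := prefixCount_UDUD B hB.ge
      rw [hB] at this
      simpa [Nat.choose] using this)
  have h2 := prefixCount_UDUD A (by omega)
  simp at h1
  omega

theorem prefixCount_UUDDD (A : Finset α) (h : 6 ≤ A.card) :
    prefixCount A [false, false, true, true, true] 3 + A.card.choose 4 * 3 + 1 =
      A.card.choose 5 * 6 + A.card.choose 3 := by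
  have h1 := prefixCount_append_true A (p := [false, false, true, true]) (m := 6) h
    (fun B hB => by
      have := prefixCount_UUDD B hB.ge
      rw [hB] at this
      simpa [Nat.choose] using this)
  have h2 := prefixCount_UUDD A (by omega)
  simp at h1
  omega

/-- The recursion on the number of descents for the words with a given prefix ending in a
descent. -/
theorem prefixCount_append_true_succ (A : Finset α) {p : List Bool} {d m : ℕ}
    (h : p.length + 1 < A.card) (hd : d ≤ 3)
    (hm : ∀ B : Finset α, B.card = p.length + 1 → prefixCount B p (p.count true) = m) :
    (prefixCount A (p ++ [true]) (p.count true + d + 1) : ℚ) =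
      A.card.choose (p.length + 1) * m * ((A.card - (p.length + 1)).factorial *
        PowerSeries.coeff (A.card - (p.length + 1)) (eulerianEgf d))
      - prefixCount A p (p.count true + d) + prefixCount A (p ++ [true]) (p.count true + d) := by
  rw [← prefixCount_false_add_prefixCount_true A h hd hm,
    prefixCount_append_singleton A (p.count true + d) h]
  push_cast
  ring

theorem prefixCount_D (A : Finset α) (h : 2 ≤ A.card) {d : ℕ} (hd : d ≤ 3) :
    (prefixCount A [true] (d + 1) : ℚ) =
      A.card * ((A.card - 1).factorial * PowerSeries.coeff (A.card - 1) (eulerianEgf d))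
        - A.card.factorial * PowerSeries.coeff A.card (eulerianEgf d) + prefixCount A [true] d := by
  have := prefixCount_append_true_succ A (p := []) h hd
    (fun B _ => prefixCount_zero_of_nil B)
  simpa [prefixCount_nil A hd] using this

theorem prefixCount_D_one (A : Finset α) (h : 2 ≤ A.card) :
    (prefixCount A [true] 1 : ℚ) = A.card - 1 := by
  rw [prefixCount_D A h (by norm_num), prefixCount_eq_zero A (p := [true]) (by simp)]
  simp [factorial_mul_coeff_eulerianEgf_zero]

theorem prefixCount_D_three (A : Finset α) (h : 2 ≤ A.card) :
    (prefixCount A [true] 3 : ℚ) =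
      A.card * 3 ^ (A.card - 1) - 3 ^ A.card - (A.card ^ 2 - A.card) * 2 ^ (A.card - 1)
        + A.card * 2 ^ A.card + (A.card ^ 3 - 4 * A.card ^ 2 + 3 * A.card) / 2 := by
  rw [prefixCount_D A h (by norm_num), prefixCount_D A h (by norm_num), prefixCount_D_one A h]
  simp only [factorial_mul_coeff_eulerianEgf_one, factorial_mul_coeff_eulerianEgf_two]
  rw [Nat.cast_sub (by omega : 1 ≤ A.card)]
  push_cast
  ring

theorem prefixCount_UD_two (A : Finset α) (h : 3 ≤ A.card) :
    (prefixCount A [false, true] 2 : ℚ) =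
      A.card.choose 2 * (2 ^ (A.card - 2) - A.card + 2) - 2 ^ A.card + 2 * A.card - 1 := by
  have h1 := prefixCount_append_true_succ A (p := [false]) (d := 1) h (by norm_num)
    (fun B hB => prefixCount_U B hB.ge)
  have h2 := prefixCount_append_singleton A (p := []) 1 (by simp; omega)
  have h3 := prefixCount_nil A (d := 1) (by norm_num)
  have h4 := prefixCount_D_one A (by omega)
  have h5 := prefixCount_UD A h
  qify at h2 h5
  simp [factorial_mul_coeff_eulerianEgf_one] at h1 h2 h3
  rw [Nat.cast_sub (by omega : 2 ≤ A.card)] at h1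
  push_cast at h1
  linear_combination h1 + h2 - h3 + h4 + h5

theorem prefixCount_UDD_three (A : Finset α) (h : 4 ≤ A.card) :
    (prefixCount A [false, true, true] 3 : ℚ) =
      2 * A.card.choose 3 * (2 ^ (A.card - 3) - A.card + 3)
        - A.card.choose 2 * (2 ^ (A.card - 2) - A.card + 3) + 2 ^ A.card - 2 * A.card + 2 := by
  have hm (B : Finset α) (hB : B.card = [false, true].length + 1) :
      prefixCount B [false, true] ([false, true].count true) = 2 := by
    have := prefixCount_UD B hB.ge
    rw [hB] at this
    simpa [Nat.choose] using this
  have h1 := prefixCount_append_true_succ A (p := [false, true]) (d := 1) h (by norm_num) hm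
  have h2 := prefixCount_append_true A (p := [false, true]) h hm
  have h3 := prefixCount_UD A (by omega)
  have h4 := prefixCount_UD_two A (by omega)
  qify at h2 h3
  simp [factorial_mul_coeff_eulerianEgf_one] at h1 h2
  rw [Nat.cast_sub (by omega : 3 ≤ A.card)] at h1
  push_cast at h1
  linear_combination h1 + h2 - h3 - h4

/-- A word satisfying the ballot condition, where `true` stands for a descent and `false` for an
ascent. -/
def IsBallotWord (w : List Bool) : Prop := ∀ j ≤ w.length, 2 * (w.take j).count true ≤ j

theorem card_descentSet : ∀ w : List ℕ, (descentSet w).card = des w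
  | [] => rfl
  | [_] => rfl
  | a :: b :: l => by
    have ih := card_descentSet (b :: l)
    simp only [descentSet, Finset.card_filter, List.length_cons, Nat.add_sub_cancel] at ih ⊢
    rw [Finset.sum_range_succ']
    simp only [List.getD_cons_succ, List.getD_cons_zero] at ih ⊢
    rw [ih]
    by_cases h : b < a <;> simp [des, descentWord, h]

theorem card_ascentSet_add_des {w : List ℕ} (hw : w.Nodup) :
    (ascentSet w).card + des w = w.length - 1 := by
  have hnot : ascentSet w = (Finset.range (w.length - 1)).filter
      fun i => ¬ w.getD (i + 1) 0 < w.getD i 0 := by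
    refine Finset.filter_congr fun i hi => ?_
    rw [Finset.mem_range] at hi
    rw [List.getD_eq_getElem _ _ (by omega : i < w.length),
      List.getD_eq_getElem _ _ (by omega : i + 1 < w.length)]
    have hne : w[i] ≠ w[i + 1] := by simp [ne_eq, hw.getElem_inj_iff]
    omega
  rw [hnot, ← card_descentSet, descentSet, add_comm, Finset.card_filter_add_card_filter_not,
    Finset.card_range]

variable {n : ℕ}

theorem permWord_mem_arrangements (π : Equiv.Perm (Fin n)) :
    permWord π ∈ arrangements (Finset.Icc 1 n) := by
  rw [mem_arrangements, permWord]
  refine ⟨(List.nodup_finRange n).map fun i j h => ?_, fun x => ?_⟩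
  · exact π.injective (Fin.ext (Nat.succ_injective h))
  · simp only [List.mem_map, List.mem_finRange, true_and, Finset.mem_Icc]
    constructor
    · rintro ⟨i, rfl⟩
      omega
    · intro hx
      exact ⟨π.symm ⟨x - 1, by omega⟩, by simp; omega⟩

theorem permWord_injective : Function.Injective (permWord (n := n)) := by
  intro π σ h
  rw [permWord, permWord, List.map_inj_left] at h
  ext i
  simpa using h i (List.mem_finRange i)

theorem card_filter_permWord (P : List ℕ → Prop) [DecidablePred P] :
    (Finset.univ.filter fun π : Equiv.Perm (Fin n) => P (permWord π)).card =
      ((arrangements (Finset.Icc 1 n)).filter P).card := by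
  have himage : Finset.univ.image (permWord (n := n)) = arrangements (Finset.Icc 1 n) := by
    refine Finset.eq_of_subset_of_card_le ?_ ?_
    · simp [Finset.image_subset_iff, permWord_mem_arrangements]
    · rw [Finset.card_image_of_injective _ permWord_injective, card_arrangements]
      simp [Fintype.card_perm]
  rw [← himage, Finset.filter_image, Finset.card_image_of_injective _ permWord_injective]

theorem eulerianNum_eq {d : ℕ} (hd : d ≤ 3) :
    (eulerianNum n d : ℚ) = n.factorial * PowerSeries.coeff n (eulerianEgf d) := by
  have := prefixCount_nil (Finset.Icc 1 n) hd
  rw [Nat.card_Icc, Nat.add_sub_cancel] at this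
  rw [← this, eulerianNum, prefixCount]
  simp only [descentCount, card_descentSet, List.nil_prefix, true_and]
  rw [card_filter_permWord fun w => des w = d]

theorem isBallot_iff (π : Equiv.Perm (Fin n)) :
    IsBallot π ↔ IsBallotWord (descentWord (permWord π)) := by
  have hlen : (permWord π).length = n := by simp [permWord]
  have hasc (k : ℕ) := card_ascentSet_add_des
    ((mem_arrangements.1 (permWord_mem_arrangements π)).1.sublist (List.take_sublist k _))
  have hdes (j : ℕ) : des ((permWord π).take (j + 1)) =
      ((descentWord (permWord π)).take j).count true := by
    rw [des, descentWord_take]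
  rw [IsBallot, IsBallotWord, length_descentWord, hlen]
  simp only [card_descentSet]
  constructor
  · intro h j hj
    rw [← hdes]
    have h1 := hasc (j + 1)
    rw [List.length_take, hlen] at h1
    rcases Nat.eq_zero_or_pos n with rfl | hn
    · have := des_le ((permWord π).take (j + 1))
      simp [hlen] at this
      omega
    · have := h (j + 1) (by omega)
      omega
  · rintro h (_ | j) hj
    · simp [des, descentWord]
    · have h1 := hasc (j + 1)
      rw [List.length_take, hlen] at h1
      have := h j (by omega)
      rw [← hdes] at this
      omega

theorem bCount_eq (n d : ℕ) : bCount n d = ((arrangements (Finset.Icc 1 n)).filter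
    fun l => IsBallotWord (descentWord l) ∧ des l = d).card := by
  rw [← card_filter_permWord, bCount]
  congr 1
  ext π
  simp [isBallot_iff, descentCount, card_descentSet]

theorem bCount_three_eq_zero {n : ℕ} (hn : n ≤ 6) : bCount n 3 = 0 := by
  rw [bCount_eq, Finset.card_eq_zero, Finset.filter_eq_empty_iff]
  rintro l hl ⟨hb, hd⟩
  have := hb _ le_rfl
  rw [List.take_length, ← des, hd, length_descentWord, length_of_mem_arrangements hl,
    Nat.card_Icc] at this
  omega

/-- A word with three descents fails to be ballot in exactly one of four ways. -/
theorem ite_isBallotWord_add {w : List Bool} (hlen : 5 ≤ w.length) (hw : w.count true = 3) :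
    (if IsBallotWord w then 1 else 0) + (if [true] <+: w then 1 else 0)
      + (if [false, true, true] <+: w then 1 else 0)
      + (if [false, true, false, true, true] <+: w then 1 else 0)
      + (if [false, false, true, true, true] <+: w then 1 else 0) = 1 := by
  obtain ⟨a, b, c, d, e, s, rfl⟩ : ∃ a b c d e s, w = a :: b :: c :: d :: e :: s := by
    match w, hlen with
    | a :: b :: c :: d :: e :: s, _ => exact ⟨a, b, c, d, e, s, rfl⟩
  have hB : IsBallotWord (a :: b :: c :: d :: e :: s) ↔
      ∀ j < 6, 2 * ([a, b, c, d, e].take j).count true ≤ j := by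
    have htake (j : ℕ) (hj : j < 6) :
        (a :: b :: c :: d :: e :: s).take j = [a, b, c, d, e].take j := by
      interval_cases j <;> rfl
    constructor
    · intro h j hj
      rw [← htake j hj]
      exact h j (by simp; omega)
    · intro h j hj
      by_cases hj6 : j < 6
      · rw [htake j hj6]
        exact h j hj6
      · have := (List.take_sublist j (a :: b :: c :: d :: e :: s)).count_le true
        omega
  have hcount : [a, b, c, d, e].count true ≤ 3 := by
    rw [← hw]
    exact (List.prefix_append [a, b, c, d, e] s).sublist.count_le true
  simp only [hB, List.cons_prefix_cons, List.nil_prefix, and_true]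
  clear hw hB hlen
  revert a b c d e
  decide

theorem bCount_three_add {n : ℕ} (hn : 6 ≤ n) :
    bCount n 3 + prefixCount (Finset.Icc 1 n) [true] 3
      + prefixCount (Finset.Icc 1 n) [false, true, true] 3
      + prefixCount (Finset.Icc 1 n) [false, true, false, true, true] 3
      + prefixCount (Finset.Icc 1 n) [false, false, true, true, true] 3 = eulerianNum n 3 := by
  have hE : eulerianNum n 3 =
      ((arrangements (Finset.Icc 1 n)).filter fun l => des l = 3).card := by
    simp only [eulerianNum, descentCount, card_descentSet]
    rw [card_filter_permWord fun w => des w = 3]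
  rw [hE, bCount_eq]
  simp only [prefixCount, Finset.card_filter, ← Finset.sum_add_distrib]
  refine Finset.sum_congr rfl fun l hl => ?_
  by_cases h : des l = 3
  · have hlen : 5 ≤ (descentWord l).length := by
      rw [length_descentWord, length_of_mem_arrangements hl, Nat.card_Icc]
      omega
    have := ite_isBallotWord_add hlen h
    simpa [h] using this
  · simp [h]

end Ballot
theorem ballot_eq_odd_order_three_descents (n : ℕ) (hn : 4 ≤ n) :
    bCount n 3 = pCount n 3 ∧
      (bCount n 3 : ℤ) =
        4 * eulerianNum (n - 1) 3 - ((n.choose 3 : ℤ) - n.choose 2 + 4) * 2 ^ (n - 2)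
          - 22 * n.choose 5 + 16 * n.choose 4 - 4 * n.choose 3 + 2 * n := by
  have hp := pCount_three n hn
  have hE := eulerianNum_eq (n := n - 1) (le_refl 3)
  rw [factorial_mul_coeff_eulerianEgf_three] at hE
  suffices h : (bCount n 3 : ℚ) = pCount n 3 ∧ (bCount n 3 : ℚ) =
      4 * eulerianNum (n - 1) 3 - ((n.choose 3 : ℚ) - n.choose 2 + 4) * 2 ^ (n - 2)
        - 22 * n.choose 5 + 16 * n.choose 4 - 4 * n.choose 3 + 2 * n by
    exact ⟨by exact_mod_cast h.1, by exact_mod_cast h.2⟩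
  rw [hp, hE]
  rcases le_or_gt 6 n with h6 | h6
  · have hb := bCount_three_add h6
    have hc : (Finset.Icc 1 n).card = n := by simp
    have h1 := prefixCount_D_three (Finset.Icc 1 n) (by omega)
    have h2 := prefixCount_UDD_three (Finset.Icc 1 n) (by omega)
    have h3 := prefixCount_UDUDD (Finset.Icc 1 n) (by omega)
    have h4 := prefixCount_UUDDD (Finset.Icc 1 n) (by omega)
    have h5 := eulerianNum_eq (n := n) (le_refl 3)
    rw [factorial_mul_coeff_eulerianEgf_three] at h5
    qify at hb h3 h4
    rw [hc] at h1 h2 h3 h4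
    have hchoose (k : ℕ) : (n.choose k : ℚ) = n.descFactorial k / k.factorial := by
      rw [Nat.descFactorial_eq_factorial_mul_choose, Nat.cast_mul,
        mul_div_cancel_left₀ _ (by positivity)]
    obtain ⟨k, rfl⟩ := Nat.exists_eq_add_of_le' h6
    simp only [hchoose, Nat.descFactorial_succ, Nat.descFactorial_zero,
      Nat.reduceSubDiff, Nat.factorial, Nat.sub_zero] at h1 h2 h3 h4 h5 ⊢
    push_cast at h1 h2 h3 h4 h5 ⊢
    constructor <;> linear_combination hb - h1 - h2 - h3 - h4 + h5
  · rw [bCount_three_eq_zero h6.le]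
    interval_cases n <;> norm_num [Nat.descFactorial, Nat.choose]
end

section
/- For all n ≥ 1 and all d ≥ 0, the number a(n,d) of permutations of {1,…,n} with exactly d descents whose first position is an ascent (i.e. π_1 < π_2, or n = 1 with d = 0) satisfies a(n,d) = (d+1)·E(n−1,d). -/
open Finset
open scoped Classical

/-- `a(n,d)`: the number of permutations of `{1,…,n}` with exactly `d` descents which
begin with an ascent (for `n = 1` the unique permutation is counted when `d = 0`). -/
noncomputable def aCount (n d : ℕ) : ℕ :=
  (Finset.univ.filter fun π : Equiv.Perm (Fin n) =>
    descentCount π = d ∧ (n = 1 ∨ 0 ∈ ascentSet (permWord π))).card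

/-- The number of descents, counted over the positions in `Fin n`. -/
theorem descentCount_eq_sum {n : ℕ} (π : Equiv.Perm (Fin (n + 1))) :
    descentCount π = ∑ i : Fin n, if π i.succ < π i.castSucc then 1 else 0 := by
  rw [descentCount, descentSet, Finset.card_filter]
  simp only [permWord, List.length_map, List.length_finRange, Nat.add_sub_cancel]
  rw [Finset.sum_range]
  refine Finset.sum_congr rfl fun i _ => ?_
  have hi := i.isLt
  have h₁ : (i : ℕ) < n + 1 := by omega
  have h₂ : (i : ℕ) + 1 < n + 1 := by omega
  have e₁ : (⟨i, h₁⟩ : Fin (n + 1)) = i.castSucc := rfl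
  have e₂ : (⟨i + 1, h₂⟩ : Fin (n + 1)) = i.succ := rfl
  simp [List.getD_eq_getElem?_getD, h₁, e₁, e₂]

theorem zero_mem_ascentSet_permWord {n : ℕ} (π : Equiv.Perm (Fin (n + 2))) :
    0 ∈ ascentSet (permWord π) ↔ π 0 < π 1 := by
  simp [ascentSet, permWord, List.getD_eq_getElem?_getD]

/-- The number of cyclic descents of a permutation. -/
def cyclicDescentCount {n : ℕ} (π : Equiv.Perm (Fin (n + 1))) : ℕ :=
  ∑ i, if π (i + 1) < π i then 1 else 0

theorem mul_cyclicDescentCount {n : ℕ} (π : Equiv.Perm (Fin (n + 1))) :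
    (n + 1) * cyclicDescentCount π = ∑ i, (π (i + 1) - π i : Fin (n + 1)).val := by
  have key : ∀ i, ((π (i + 1) - π i : Fin (n + 1)).val : ℤ) =
      (n + 1) * (if π (i + 1) < π i then 1 else 0) + ((π (i + 1)).val - (π i).val : ℤ) := by
    intro i
    split_ifs with h
    · rw [Fin.coe_sub_iff_lt.mpr h]
      have := Fin.lt_def.mp h
      omega
    · rw [Fin.coe_sub_iff_le.mpr (not_lt.mp h)]
      have := Fin.le_def.mp (not_lt.mp h)
      omega
  have shift : ∑ i, ((π (i + 1)).val : ℤ) = ∑ i, ((π i).val : ℤ) :=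
    Equiv.sum_comp (Equiv.addRight (1 : Fin (n + 1))) fun i => ((π i).val : ℤ)
  zify
  simp only [key, Finset.sum_add_distrib, Finset.sum_sub_distrib, shift, ← Finset.mul_sum,
    cyclicDescentCount]
  simp

/-- Rotating the values preserves the number of cyclic descents. -/
theorem cyclicDescentCount_addRight_mul {n : ℕ} (k : Fin (n + 1)) (π : Equiv.Perm (Fin (n + 1))) :
    cyclicDescentCount (Equiv.addRight k * π) = cyclicDescentCount π := by
  have h := mul_cyclicDescentCount (Equiv.addRight k * π)
  simp only [Equiv.Perm.mul_apply, Equiv.coe_addRight, add_sub_add_right_eq_sub] at h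
  rw [← mul_cyclicDescentCount] at h
  exact Nat.eq_of_mul_eq_mul_left n.succ_pos h

/-- Rotating the positions preserves the number of cyclic descents. -/
theorem cyclicDescentCount_mul_addRight {n : ℕ} (k : Fin (n + 1)) (π : Equiv.Perm (Fin (n + 1))) :
    cyclicDescentCount (π * Equiv.addRight k) = cyclicDescentCount π := by
  rw [cyclicDescentCount, cyclicDescentCount,
    ← Equiv.sum_comp (Equiv.addRight k) fun i => if π (i + 1) < π i then 1 else 0]
  refine Finset.sum_congr rfl fun i _ => ?_
  rw [Equiv.Perm.mul_apply, Equiv.Perm.mul_apply, Equiv.coe_addRight, add_right_comm]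

/-- The permutation of `Fin (n + 1)` fixing `0` and acting as `σ` on the successors. -/
def extendZero {n : ℕ} (σ : Equiv.Perm (Fin n)) : Equiv.Perm (Fin (n + 1)) :=
  Equiv.Perm.decomposeFin.symm (0, σ)

@[simp]
theorem extendZero_zero {n : ℕ} (σ : Equiv.Perm (Fin n)) : extendZero σ 0 = 0 := by
  simp [extendZero]

@[simp]
theorem extendZero_succ {n : ℕ} (σ : Equiv.Perm (Fin n)) (i : Fin n) :
    extendZero σ i.succ = (σ i).succ := by
  simp [extendZero]

@[simp]
theorem extendZero_one {n : ℕ} (σ : Equiv.Perm (Fin (n + 1))) :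
    extendZero σ 1 = (σ 0).succ :=
  extendZero_succ σ 0

/-- A permutation is determined by its first value `k` and the permutation that remains once
`k` is moved to the front by a fixed rule. -/
theorem bijective_mul_extendZero {n : ℕ} (ρ : Fin (n + 1) → Equiv.Perm (Fin (n + 1)))
    (hρ : ∀ k, ρ k 0 = k) :
    Function.Bijective fun p : Equiv.Perm (Fin n) × Fin (n + 1) => ρ p.2 * extendZero p.1 := by
  rw [Fintype.bijective_iff_injective_and_card]
  constructor
  · rintro ⟨σ, k⟩ ⟨τ, l⟩ h
    dsimp only at h
    have hkl : k = l := by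
      have h0 := congrArg (fun π : Equiv.Perm (Fin (n + 1)) => π 0) h
      simpa [hρ] using h0
    subst hkl
    have h' := Equiv.Perm.decomposeFin.symm.injective (mul_left_cancel h)
    simpa using h'
  · simp [Fintype.card_perm, Nat.factorial_succ, mul_comm]

theorem card_filter_perm_eq_sum {n : ℕ} (ρ : Fin (n + 1) → Equiv.Perm (Fin (n + 1)))
    (hρ : ∀ k, ρ k 0 = k) (P : Equiv.Perm (Fin (n + 1)) → Prop) [DecidablePred P] :
    #{π | P π} = ∑ σ : Equiv.Perm (Fin n), #{k | P (ρ k * extendZero σ)} := by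
  simp only [Finset.card_filter]
  rw [← (bijective_mul_extendZero ρ hρ).sum_comp fun π => if P π then 1 else 0,
    Fintype.sum_prod_type]

theorem cyclicDescentCount_extendZero {n : ℕ} (σ : Equiv.Perm (Fin (n + 1))) :
    cyclicDescentCount (extendZero σ) = descentCount σ + 1 := by
  rw [cyclicDescentCount, Fin.sum_univ_succ, Fin.sum_univ_castSucc, descentCount_eq_sum]
  have h : ∀ i : Fin n, i.castSucc.succ + 1 = i.succ.succ := by
    intro i
    rw [← Fin.castSucc_succ, Fin.coeSucc_eq_succ]
  have hl : (Fin.last n).succ + 1 = 0 := by simp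
  simp [h, -Fin.castSucc_succ, -Fin.succ_last, hl]

theorem descentCount_cycleRange_symm_mul {n : ℕ} (k : Fin (n + 2)) (σ : Equiv.Perm (Fin (n + 1))) :
    descentCount (k.cycleRange.symm * extendZero σ) =
      (if k.succAbove (σ 0) < k then 1 else 0) + descentCount σ := by
  rw [descentCount_eq_sum, Fin.sum_univ_succ, descentCount_eq_sum]
  simp

theorem aCount_eq_sum (n d : ℕ) :
    aCount (n + 2) d =
      ∑ σ : Equiv.Perm (Fin (n + 1)), if descentCount σ = d then (σ 0).val + 1 else 0 := by
  rw [aCount, card_filter_perm_eq_sum (fun k => k.cycleRange.symm) (by simp)]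
  refine Finset.sum_congr rfl fun σ _ => ?_
  have h : ∀ k : Fin (n + 2),
      (descentCount (k.cycleRange.symm * extendZero σ) = d ∧ (n + 2 = 1 ∨
        0 ∈ ascentSet (permWord (k.cycleRange.symm * extendZero σ)))) ↔
      (descentCount σ = d ∧ k ≤ (σ 0).castSucc) := by
    intro k
    rw [zero_mem_ascentSet_permWord, descentCount_cycleRange_symm_mul]
    simp only [Equiv.Perm.mul_apply, extendZero_zero, extendZero_one, Fin.cycleRange_symm_zero,
      Fin.cycleRange_symm_succ, Fin.lt_succAbove_iff_le_castSucc]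
    have : k ≤ (σ 0).castSucc → ¬ k.succAbove (σ 0) < k := fun hk =>
      not_lt.mpr ((Fin.lt_succAbove_iff_le_castSucc _ _).mpr hk).le
    by_cases hk : k ≤ (σ 0).castSucc <;> simp [hk, this]
  simp only [h]
  split_ifs with hd
  · simp only [hd, true_and]
    rw [show ({k | k ≤ (σ 0).castSucc} : Finset (Fin (n + 2))) = Finset.Iic (σ 0).castSucc by
      ext; simp, Fin.card_Iic, Fin.val_castSucc]
  · simp [hd]

theorem card_filter_cyclicDescentCount_and_zero (n d : ℕ) :
    #{π : Equiv.Perm (Fin (n + 2)) | cyclicDescentCount π = d + 1 ∧ π 1 < π 0} =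
      ∑ σ : Equiv.Perm (Fin (n + 1)), if descentCount σ = d then (σ 0).val + 1 else 0 := by
  rw [card_filter_perm_eq_sum (fun k => Equiv.addRight k) (by simp)]
  refine Finset.sum_congr rfl fun σ _ => ?_
  simp only [cyclicDescentCount_addRight_mul, cyclicDescentCount_extendZero, add_left_inj,
    Equiv.Perm.mul_apply, extendZero_zero, extendZero_one, Equiv.coe_addRight, zero_add]
  split_ifs with hd
  · simp only [hd, true_and]
    have h : ∀ k : Fin (n + 2), (σ 0).succ + k < k ↔ (σ 0).rev.succ ≤ k := by
      intro k
      rw [Fin.lt_def, Fin.le_def, Fin.val_add_eq_ite]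
      simp only [Fin.val_succ, Fin.val_rev]
      split_ifs <;> omega
    simp only [h]
    rw [show ({k | (σ 0).rev.succ ≤ k} : Finset (Fin (n + 2))) = Finset.Ici (σ 0).rev.succ by
      ext; simp, Fin.card_Ici, Fin.val_succ, Fin.val_rev]
    omega
  · simp [hd]

theorem card_filter_cyclicDescentCount (n d : ℕ) :
    #{π : Equiv.Perm (Fin (n + 2)) | cyclicDescentCount π = d + 1} =
      (n + 2) * eulerianNum (n + 1) d := by
  rw [card_filter_perm_eq_sum (fun k => Equiv.addRight k) (by simp), eulerianNum,
    Finset.card_filter, Finset.mul_sum]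
  refine Finset.sum_congr rfl fun σ _ => ?_
  simp only [cyclicDescentCount_addRight_mul, cyclicDescentCount_extendZero, add_left_inj]
  split_ifs with hd <;> simp [hd]

/-- By rotating positions, each position is equally often a cyclic descent. -/
theorem mul_card_filter_cyclicDescentCount_and_zero (n c : ℕ) :
    (n + 1) * #{π : Equiv.Perm (Fin (n + 1)) | cyclicDescentCount π = c ∧ π 1 < π 0} =
      c * #{π : Equiv.Perm (Fin (n + 1)) | cyclicDescentCount π = c} := by
  have rot : ∀ i : Fin (n + 1),
      #{π : Equiv.Perm (Fin (n + 1)) | cyclicDescentCount π = c ∧ π (i + 1) < π i} =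
        #{π : Equiv.Perm (Fin (n + 1)) | cyclicDescentCount π = c ∧ π 1 < π 0} := by
    intro i
    refine Finset.card_equiv (Equiv.mulRight (Equiv.addRight i)) fun π => ?_
    simp [cyclicDescentCount_mul_addRight, add_comm]
  calc _ = ∑ i : Fin (n + 1),
        #{π : Equiv.Perm (Fin (n + 1)) | cyclicDescentCount π = c ∧ π (i + 1) < π i} := by
        simp [rot]
    _ = ∑ π : Equiv.Perm (Fin (n + 1)) with cyclicDescentCount π = c, cyclicDescentCount π := by
        simp only [← Finset.filter_filter, Finset.card_filter _ (Finset.filter _ _)]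
        rw [Finset.sum_comm]
        rfl
    _ = _ := by
        rw [Finset.sum_congr rfl fun π hπ => (Finset.mem_filter.mp hπ).2]
        simp [mul_comm]

theorem ascent_start_count (n : ℕ) (hn : 1 ≤ n) (d : ℕ) :
    aCount n d = (d + 1) * eulerianNum (n - 1) d := by
  obtain ⟨n, rfl⟩ := Nat.exists_eq_add_of_le' hn
  cases n with
  | zero =>
    have h : ∀ π : Equiv.Perm (Fin 0), descentCount π = 0 := fun π => by
      simp [descentCount, descentSet, permWord]
    cases d <;> simp [aCount, eulerianNum, descentCount_eq_sum, h]
  | succ n =>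
    refine Nat.eq_of_mul_eq_mul_left (n + 1).succ_pos ?_
    have h := mul_card_filter_cyclicDescentCount_and_zero (n + 1) (d + 1)
    rw [card_filter_cyclicDescentCount, card_filter_cyclicDescentCount_and_zero,
      ← aCount_eq_sum] at h
    rw [Nat.add_sub_cancel, Nat.succ_eq_add_one, h]
    ring
end

section
/- For all n ≥ 0, b(2n+1, n) = p(2n+1, n) = EC(n), where EC(n) = 2·E(2n, n−1) is the n-th Eulerian-Catalan number. -/
open Finset
open scoped Classical

/-- The sign of the step from position `j` to position `j + 1` of the one-line word of `σ`,
read cyclically. -/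
def cyclicStep {K : ℕ} (σ : Equiv.Perm (Fin (K + 1))) (j : ℕ) : ℤ :=
  if σ (Fin.ofNat (K + 1) j) < σ (Fin.ofNat (K + 1) (j + 1)) then 1 else -1

theorem cyclicStep_add_period {K : ℕ} (σ : Equiv.Perm (Fin (K + 1))) (j : ℕ) :
    cyclicStep σ (j + (K + 1)) = cyclicStep σ j := by
  have h : ∀ i, Fin.ofNat (K + 1) (i + (K + 1)) = Fin.ofNat (K + 1) i := fun i => by
    ext; simp
  unfold cyclicStep
  rw [show j + (K + 1) + 1 = (j + 1) + (K + 1) by ring, h, h]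

theorem cyclicStep_mul_addRight {K : ℕ} (σ : Equiv.Perm (Fin (K + 1))) (k j : ℕ) :
    cyclicStep (σ * Equiv.addRight (Fin.ofNat (K + 1) k)) j = cyclicStep σ (k + j) := by
  have h : ∀ i, Fin.ofNat (K + 1) i + Fin.ofNat (K + 1) k = Fin.ofNat (K + 1) (k + i) :=
    fun i => by ext; simp [Fin.val_add, add_comm]
  simp only [cyclicStep, Equiv.Perm.mul_apply, Equiv.coe_addRight, h]
  rfl

theorem getD_permWord {n : ℕ} (σ : Equiv.Perm (Fin n)) {i : ℕ} (hi : i < n) :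
    (permWord σ).getD i 0 = (σ ⟨i, hi⟩ : ℕ) + 1 := by
  simp [permWord, List.getD_eq_getElem?_getD, hi]

theorem apply_ofNat_ne_apply_ofNat_succ {K j : ℕ} (σ : Equiv.Perm (Fin (K + 1))) (hj : j < K) :
    σ (Fin.ofNat (K + 1) j) ≠ σ (Fin.ofNat (K + 1) (j + 1)) := fun h => by
  have h' := congrArg Fin.val (σ.injective h)
  simp only [Fin.val_ofNat] at h'
  rw [Nat.mod_eq_of_lt (by omega), Nat.mod_eq_of_lt (by omega)] at h'
  omega

theorem card_descentSet_add_card_ascentSet_take {K m : ℕ} (σ : Equiv.Perm (Fin (K + 1)))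
    (hm : m ≤ K) :
    (descentSet ((permWord σ).take (m + 1))).card +
        (ascentSet ((permWord σ).take (m + 1))).card = m ∧
      ((ascentSet ((permWord σ).take (m + 1))).card : ℤ) -
        (descentSet ((permWord σ).take (m + 1))).card = ∑ j ∈ range m, cyclicStep σ j := by
  have hlen : ((permWord σ).take (m + 1)).length - 1 = m := by
    simp [permWord]; omega
  have hget : ∀ i, i ≤ m → ((permWord σ).take (m + 1)).getD i 0 =
      (σ (Fin.ofNat (K + 1) i) : ℕ) + 1 := fun i hi => by
    have : Fin.ofNat (K + 1) i = ⟨i, by omega⟩ := by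
      ext; simp; omega
    rw [this, ← getD_permWord σ (by omega)]
    simp [List.getD_eq_getElem?_getD, Nat.lt_succ_of_le hi]
  have hasc : ascentSet ((permWord σ).take (m + 1)) =
      (range m).filter fun j => σ (Fin.ofNat (K + 1) j) < σ (Fin.ofNat (K + 1) (j + 1)) := by
    unfold ascentSet
    rw [hlen]
    refine filter_congr fun i hi => ?_
    have := mem_range.1 hi
    rw [hget i (by omega), hget (i + 1) (by omega), Fin.lt_def]
    omega
  have hdes : descentSet ((permWord σ).take (m + 1)) =
      (range m).filter fun j => ¬ σ (Fin.ofNat (K + 1) j) < σ (Fin.ofNat (K + 1) (j + 1)) := by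
    unfold descentSet
    rw [hlen]
    refine filter_congr fun i hi => ?_
    have := mem_range.1 hi
    rw [hget i (by omega), hget (i + 1) (by omega), Fin.lt_def]
    have hne := Fin.val_ne_of_ne (apply_ofNat_ne_apply_ofNat_succ σ (show i < K by omega))
    omega
  constructor
  · rw [hasc, hdes, add_comm, card_filter_add_card_filter_not, card_range]
  · rw [hasc, hdes]
    simp only [cyclicStep, sum_ite, sum_const, nsmul_eq_mul]
    ring

theorem isBallot_iff_s5 {K : ℕ} (σ : Equiv.Perm (Fin (K + 1))) :
    IsBallot σ ↔ ∀ m ≤ K, 0 ≤ ∑ j ∈ range m, cyclicStep σ j := by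
  constructor
  · intro h m hm
    have := h (m + 1) (by omega)
    have h2 := (card_descentSet_add_card_ascentSet_take σ hm).2
    omega
  · rintro h (_ | m) hm
    · simp [descentSet]
    · have := h m (by omega)
      have h2 := (card_descentSet_add_card_ascentSet_take σ (show m ≤ K by omega)).2
      omega

theorem sum_cyclicStep_range {K : ℕ} (σ : Equiv.Perm (Fin (K + 1))) :
    ∑ j ∈ range K, cyclicStep σ j = K - 2 * descentCount σ := by
  have h := card_descentSet_add_card_ascentSet_take σ le_rfl
  have : (permWord σ).take (K + 1) = permWord σ :=
    List.take_of_length_le (by simp [permWord])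
  rw [this] at h
  unfold descentCount
  omega

/-- A cycle lemma: a `±1` walk whose increments are periodic with odd period `2n + 1` and have
sum `±1` over a period has exactly one starting point, up to the period, from which the next
`2n` steps form a Dyck path. -/
theorem exists_dyck_start {P : ℕ → ℤ} {n : ℕ} {ε : ℤ} (hε : ε = 1 ∨ ε = -1)
    (hper : ∀ m, P (m + (2 * n + 1)) = P m + ε)
    (hstep : ∀ m, P (m + 1) = P m + 1 ∨ P (m + 1) = P m - 1) :
    ∃ k, (∀ m ≤ 2 * n, P k ≤ P (k + m)) ∧ P (k + 2 * n) = P k := by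
  rcases hε with rfl | rfl
  · obtain ⟨l, hl, hmin⟩ := exists_min_image (range (2 * n + 1))
      (fun j => P j * (2 * n + 1) - j) ⟨0, by simp⟩
    simp only [mem_range] at hl hmin
    have hle : ∀ j < 2 * n + 1, P l ≤ P j := fun j hj => by
      by_contra! hc
      have := hmin j hj
      have h1 : P j + 1 ≤ P l := hc
      have h2 : (l : ℤ) ≤ 2 * n := by omega
      nlinarith
    have hlt : ∀ j < 2 * n + 1, l < j → P l < P j := fun j hj hlj => by
      by_contra! hc
      have := hmin j hj
      have h2 : (l : ℤ) < j := by omega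
      nlinarith
    have hall : ∀ j, l < j → j ≤ l + (2 * n + 1) → P l + 1 ≤ P j := fun j h1 h2 => by
      rcases lt_or_ge j (2 * n + 1) with h | h
      · exact hlt j h h1
      · obtain ⟨i, rfl⟩ := Nat.exists_eq_add_of_le' h
        rw [hper]
        have := hle i (by omega)
        omega
    have hk : P (l + 1) = P l + 1 := by
      have := hall (l + 1) (by omega) (by omega)
      have := hstep l
      omega
    refine ⟨l + 1, fun m hm => ?_, ?_⟩
    · rw [hk]
      exact hall _ (by omega) (by omega)
    · rw [hk, ← hper l]
      congr 1
      ring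
  · obtain ⟨k, hk, hmin⟩ := exists_min_image (range (2 * n + 1))
      (fun j => P j * (2 * n + 1) + j) ⟨0, by simp⟩
    simp only [mem_range] at hk hmin
    have hle : ∀ j < 2 * n + 1, P k ≤ P j := fun j hj => by
      by_contra! hc
      have := hmin j hj
      have h1 : P j + 1 ≤ P k := hc
      have h2 : (j : ℤ) ≤ 2 * n := by omega
      nlinarith
    have hlt : ∀ j < k, P k < P j := fun j hj => by
      by_contra! hc
      have := hmin j (by omega)
      have h2 : (j : ℤ) < k := by omega
      nlinarith
    have hall : ∀ m ≤ 2 * n, P k ≤ P (k + m) := fun m hm => by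
      rcases lt_or_ge (k + m) (2 * n + 1) with h | h
      · exact hle _ h
      · obtain ⟨i, hi⟩ := Nat.exists_eq_add_of_le' h
        rw [hi, hper]
        have := hlt i (by omega)
        omega
    refine ⟨k, hall, ?_⟩
    have h1 := hall _ le_rfl
    have h2 := hstep (k + 2 * n)
    have h3 := hper k
    rw [← add_assoc] at h3
    omega

theorem dyck_start_unique_of_lt {P : ℕ → ℤ} {n : ℕ} {ε : ℤ} (hε : ε = 1 ∨ ε = -1)
    (hper : ∀ m, P (m + (2 * n + 1)) = P m + ε) {k l : ℕ} (hkl : k < l) (hl : l < 2 * n + 1)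
    (hk : (∀ m ≤ 2 * n, P k ≤ P (k + m)) ∧ P (k + 2 * n) = P k)
    (hl' : (∀ m ≤ 2 * n, P l ≤ P (l + m)) ∧ P (l + 2 * n) = P l) : False := by
  obtain ⟨d, rfl⟩ := Nat.exists_eq_add_of_lt hkl
  have h1 := hk.1 (d + 1) (by omega)
  have h2 := hk.1 d (by omega)
  have h3 := hl'.1 (2 * n - d) (by omega)
  have h4 := hl'.1 (2 * n - (d + 1)) (by omega)
  have h5 := hper (k + d)
  have h6 := hper k
  rw [show k + d + 1 + (2 * n - d) = k + (2 * n + 1) by omega] at h3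
  rw [show k + d + 1 + (2 * n - (d + 1)) = k + 2 * n by omega] at h4
  rw [show k + d + (2 * n + 1) = k + d + 1 + 2 * n by omega] at h5
  rw [← add_assoc] at h1
  omega

/-- The numbers of cyclic ascents and cyclic descents of the one-line word of `σ` differ by `1`. -/
def IsBalanced {K : ℕ} (σ : Equiv.Perm (Fin (K + 1))) : Prop :=
  ∑ j ∈ range (K + 1), cyclicStep σ j = 1 ∨ ∑ j ∈ range (K + 1), cyclicStep σ j = -1

theorem cyclicStep_eq {K : ℕ} (σ : Equiv.Perm (Fin (K + 1))) (j : ℕ) :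
    cyclicStep σ j = 1 ∨ cyclicStep σ j = -1 := by
  unfold cyclicStep
  split_ifs <;> simp

theorem isBallot_rotate_iff {n : ℕ} (σ : Equiv.Perm (Fin (2 * n + 1))) (k : ℕ) :
    (IsBallot (σ * Equiv.addRight (Fin.ofNat (2 * n + 1) k)) ∧
        descentCount (σ * Equiv.addRight (Fin.ofNat (2 * n + 1) k)) = n) ↔
      (∀ m ≤ 2 * n, ∑ j ∈ range k, cyclicStep σ j ≤ ∑ j ∈ range (k + m), cyclicStep σ j) ∧
        ∑ j ∈ range (k + 2 * n), cyclicStep σ j = ∑ j ∈ range k, cyclicStep σ j := by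
  have h := sum_cyclicStep_range (σ * Equiv.addRight (Fin.ofNat (2 * n + 1) k))
  simp only [isBallot_iff_s5, sum_range_add, cyclicStep_mul_addRight] at h ⊢
  refine and_congr (by simp) ?_
  push_cast at h
  omega

theorem existsUnique_ballot_rotation {n : ℕ} {σ : Equiv.Perm (Fin (2 * n + 1))}
    (hσ : IsBalanced σ) : ∃! k : Fin (2 * n + 1),
      IsBallot (σ * Equiv.addRight k) ∧ descentCount (σ * Equiv.addRight k) = n := by
  have hper : ∀ m, ∑ j ∈ range (m + (2 * n + 1)), cyclicStep σ j =
      ∑ j ∈ range m, cyclicStep σ j + ∑ j ∈ range (2 * n + 1), cyclicStep σ j := fun m => by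
    rw [add_comm m, sum_range_add, add_comm]
    congr 1
    refine sum_congr rfl fun j _ => ?_
    rw [add_comm, cyclicStep_add_period]
  have hstep : ∀ m, ∑ j ∈ range (m + 1), cyclicStep σ j = ∑ j ∈ range m, cyclicStep σ j + 1 ∨
      ∑ j ∈ range (m + 1), cyclicStep σ j = ∑ j ∈ range m, cyclicStep σ j - 1 := fun m => by
    rw [sum_range_succ]
    rcases cyclicStep_eq σ m with h | h <;> rw [h] <;> simp [sub_eq_add_neg]
  obtain ⟨k, hk⟩ := exists_dyck_start (P := fun m => ∑ j ∈ range m, cyclicStep σ j) hσ hper hstep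
  refine ⟨Fin.ofNat _ k, (isBallot_rotate_iff σ k).2 hk, ?_⟩
  have huniq : ∀ a b : Fin (2 * n + 1), a < b →
      (IsBallot (σ * Equiv.addRight a) ∧ descentCount (σ * Equiv.addRight a) = n) →
      (IsBallot (σ * Equiv.addRight b) ∧ descentCount (σ * Equiv.addRight b) = n) → False := by
    intro a b hab ha hb
    rw [← Fin.ofNat_val_eq_self a, isBallot_rotate_iff] at ha
    rw [← Fin.ofNat_val_eq_self b, isBallot_rotate_iff] at hb
    exact dyck_start_unique_of_lt (P := fun m => ∑ j ∈ range m, cyclicStep σ j)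
      hσ hper hab b.2 ha hb
  intro l hl
  rcases lt_trichotomy l (Fin.ofNat _ k) with h | h | h
  · exact (huniq _ _ h hl ((isBallot_rotate_iff σ k).2 hk)).elim
  · exact h
  · exact (huniq _ _ h ((isBallot_rotate_iff σ k).2 hk) hl).elim

theorem isBalanced_of_descentCount {n : ℕ} {σ : Equiv.Perm (Fin (2 * n + 1))}
    (hσ : descentCount σ = n) : IsBalanced σ := by
  have h := sum_cyclicStep_range σ
  unfold IsBalanced
  rw [sum_range_succ, h, hσ]
  rcases cyclicStep_eq σ (2 * n) with h | h <;> rw [h] <;> simp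

/-- The cyclic permutation whose cycle notation is the one-line word of `σ`. -/
def toCycle {K : ℕ} (σ : Equiv.Perm (Fin (K + 1))) : Equiv.Perm (Fin (K + 1)) :=
  σ * finRotate (K + 1) * σ⁻¹

theorem toCycle_apply {K : ℕ} (σ : Equiv.Perm (Fin (K + 1))) (i : Fin (K + 1)) :
    toCycle σ (σ i) = σ (i + 1) := by
  simp [toCycle]

theorem toCycle_eq_iff {K : ℕ} (σ τ : Equiv.Perm (Fin (K + 1))) :
    toCycle σ = toCycle τ ↔ ∃ k, τ = σ * Equiv.addRight k := by
  constructor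
  · intro h
    have key : ∀ i, σ⁻¹ (τ (i + 1)) = σ⁻¹ (τ i) + 1 := fun i => by
      rw [← toCycle_apply, ← h]
      simp [toCycle]
    refine ⟨σ⁻¹ (τ 0), Equiv.ext fun i => ?_⟩
    have : σ⁻¹ (τ i) = i + σ⁻¹ (τ 0) := by
      induction i using Fin.induction with
      | zero => simp
      | succ i ih =>
        rw [← Fin.coeSucc_eq_succ, key, ih, add_right_comm]
    change τ i = σ (i + σ⁻¹ (τ 0))
    rw [← this]
    simp
  · rintro ⟨k, rfl⟩
    refine Equiv.ext fun x => ?_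
    obtain ⟨i, rfl⟩ := (σ * Equiv.addRight k).surjective x
    rw [toCycle_apply, Equiv.Perm.mul_apply, toCycle_apply]
    simp [add_right_comm]

theorem exists_toCycle_eq {K : ℕ} (hK : 1 ≤ K) {c : Equiv.Perm (Fin (K + 1))}
    (hc : c.IsCycle) (hs : c.support = univ) : ∃ σ, toCycle σ = c := by
  have h : IsConj (finRotate (K + 1)) c := by
    refine (isCycle_finRotate_of_le (by omega)).isConj hc ?_
    rw [support_finRotate_of_le (by omega), hs]
  exact isConj_iff.1 h

theorem isCycle_toCycle {K : ℕ} (hK : 1 ≤ K) (σ : Equiv.Perm (Fin (K + 1))) :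
    (toCycle σ).IsCycle ∧ (toCycle σ).support = univ := by
  refine ⟨(isCycle_finRotate_of_le (by omega)).conj, ?_⟩
  unfold toCycle
  rw [Equiv.Perm.support_conj, support_finRotate_of_le (by omega)]
  simp

theorem card_filter_lt_add_card_filter_gt {n : ℕ} (c : Equiv.Perm (Fin n)) :
    (c.support.filter fun x => x < c x).card + (c.support.filter fun x => c x < x).card =
      c.support.card := by
  have : (c.support.filter fun x => c x < x) = c.support.filter fun x => ¬ x < c x := by
    refine filter_congr fun x hx => ?_
    have : c x ≠ x := Equiv.Perm.mem_support.1 hx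
    exact ⟨fun h => h.not_gt, fun h => lt_of_le_of_ne (not_lt.1 h) this⟩
  rw [this, card_filter_add_card_filter_not]

theorem isBalanced_iff_cycleM {n : ℕ} (hn : 1 ≤ n) (σ : Equiv.Perm (Fin (2 * n + 1))) :
    IsBalanced σ ↔ cycleM (toCycle σ) = n := by
  have hs := (isCycle_toCycle (by omega) σ).2
  have hcard : ((univ.filter fun x => x < toCycle σ x).card) +
      ((univ.filter fun x => toCycle σ x < x).card) = 2 * n + 1 := by
    simpa [hs] using card_filter_lt_add_card_filter_gt (toCycle σ)
  have hsum : ∑ j ∈ range (2 * n + 1), cyclicStep σ j =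
      2 * ((univ.filter fun x => x < toCycle σ x).card : ℤ) - (2 * n + 1) := by
    have h1 : ∑ j ∈ range (2 * n + 1), cyclicStep σ j =
        ∑ x : Fin (2 * n + 1), if x < toCycle σ x then (1 : ℤ) else -1 := by
      rw [sum_range, ← Equiv.sum_comp σ fun x => if x < toCycle σ x then (1 : ℤ) else -1]
      refine sum_congr rfl fun i _ => ?_
      have : Fin.ofNat (2 * n + 1) (i + 1) = i + 1 := by
        ext; simp [Fin.val_add]
      rw [toCycle_apply, cyclicStep, Fin.ofNat_val_eq_self, this]
    have h2 := card_filter_add_card_filter_not (s := (univ : Finset (Fin (2 * n + 1))))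
      (fun x => x < toCycle σ x)
    rw [card_univ, Fintype.card_fin] at h2
    rw [h1]
    simp only [sum_ite, sum_const, nsmul_eq_mul]
    zify at h2
    linarith
  unfold IsBalanced cycleM
  rw [hsum, hs]
  omega

/-- A family of balanced permutations containing exactly one rotation of each balanced
permutation is equinumerous with the full cycles `c` with `M(c) = n`. -/
theorem card_transversal_eq {n : ℕ} (hn : 1 ≤ n) (T : Equiv.Perm (Fin (2 * n + 1)) → Prop)
    [DecidablePred T]
    (hT : ∀ σ, T σ → IsBalanced σ)
    (huniq : ∀ σ, IsBalanced σ → ∃! k : Fin (2 * n + 1), T (σ * Equiv.addRight k)) :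
    (univ.filter T).card = (univ.filter fun c : Equiv.Perm (Fin (2 * n + 1)) =>
      (c.IsCycle ∧ c.support = univ) ∧ cycleM c = n).card := by
  have hrot : ∀ σ : Equiv.Perm (Fin (2 * n + 1)), σ * Equiv.addRight 0 = σ := fun σ => by
    ext; simp
  refine card_bij (fun σ _ => toCycle σ) (fun σ hσ => ?_) (fun σ hσ τ hτ h => ?_)
    (fun c hc => ?_)
  · have := hT σ (mem_filter.1 hσ).2
    simp only [mem_filter, mem_univ, true_and]
    exact ⟨isCycle_toCycle (by omega) σ, (isBalanced_iff_cycleM hn σ).1 this⟩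
  · have hσ' := (mem_filter.1 hσ).2
    have hτ' := (mem_filter.1 hτ).2
    obtain ⟨k, rfl⟩ := (toCycle_eq_iff σ τ).1 h
    have := (huniq σ (hT σ hσ')).unique hτ' ((hrot σ).symm ▸ hσ')
    rw [this, hrot]
  · obtain ⟨hc1, hc2⟩ := (mem_filter.1 hc).2
    obtain ⟨σ, rfl⟩ := exists_toCycle_eq (by omega) hc1.1 hc1.2
    obtain ⟨k, hk, -⟩ := huniq σ ((isBalanced_iff_cycleM hn σ).2 hc2)
    exact ⟨_, by simpa using hk, ((toCycle_eq_iff _ _).2 ⟨k, rfl⟩).symm⟩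

theorem odd_order_and_permM_eq_iff {n : ℕ} (hn : 1 ≤ n) (c : Equiv.Perm (Fin (2 * n + 1))) :
    (Odd (orderOf c) ∧ permM c = n) ↔ (c.IsCycle ∧ c.support = univ) ∧ cycleM c = n := by
  constructor
  · rintro ⟨hodd, hM⟩
    have hle : ∀ d ∈ c.cycleFactorsFinset, 2 * cycleM d + 1 ≤ d.support.card := by
      intro d hd
      have hdvd : d.support.card ∣ orderOf c := by
        refine Equiv.Perm.dvd_of_mem_cycleType ?_
        rw [Equiv.Perm.cycleType_def]
        exact Multiset.mem_map_of_mem _ hd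
      have := hodd.of_dvd_nat hdvd
      have h2 := card_filter_lt_add_card_filter_gt d
      unfold cycleM
      obtain ⟨r, hr⟩ := this
      omega
    have hsum : ∑ d ∈ c.cycleFactorsFinset, d.support.card = c.support.card := by
      rw [← Equiv.Perm.sum_cycleType, Equiv.Perm.cycleType_def]
      rfl
    have h1 := sum_le_sum hle
    rw [sum_add_distrib, ← mul_sum, hsum, sum_const, smul_eq_mul, mul_one] at h1
    have h2 : c.support.card ≤ 2 * n + 1 := by
      simpa using card_le_univ c.support
    have hM' : ∑ d ∈ c.cycleFactorsFinset, cycleM d = n := hM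
    have h3 : c.cycleFactorsFinset.card ≠ 0 := fun h => by
      rw [card_eq_zero.1 h, sum_empty] at hM'
      omega
    obtain ⟨d, hd⟩ := card_eq_one.1 (show c.cycleFactorsFinset.card = 1 by omega)
    obtain ⟨hc, rfl⟩ := Equiv.Perm.cycleFactorsFinset_eq_singleton_iff.1 hd
    refine ⟨⟨hc, ?_⟩, ?_⟩
    · rw [← card_eq_iff_eq_univ, Fintype.card_fin]
      omega
    · rwa [hd, sum_singleton] at hM'
  · rintro ⟨⟨hc, hs⟩, hM⟩
    refine ⟨?_, ?_⟩
    · rw [hc.orderOf, hs]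
      simp
    · rw [permM, hc.cycleFactorsFinset_eq_singleton, sum_singleton, hM]

theorem descentCount_revPerm_mul {K : ℕ} (σ : Equiv.Perm (Fin (K + 1))) :
    descentCount (Fin.revPerm * σ) + descentCount σ = K := by
  have h : ∑ j ∈ range K, cyclicStep (Fin.revPerm * σ) j = -∑ j ∈ range K, cyclicStep σ j := by
    rw [← sum_neg_distrib]
    refine sum_congr rfl fun j hj => ?_
    have hj := mem_range.1 hj
    have hne := apply_ofNat_ne_apply_ofNat_succ σ hj
    simp only [cyclicStep, Equiv.Perm.mul_apply, Fin.revPerm_apply, Fin.rev_lt_rev]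
    rcases lt_or_gt_of_ne hne with h | h
    · rw [if_neg h.not_gt, if_pos h]
    · rw [if_pos h, if_neg h.not_gt, neg_neg]
  rw [sum_cyclicStep_range, sum_cyclicStep_range] at h
  omega

theorem eulerianNum_symm {K d : ℕ} (hd : d ≤ K) :
    eulerianNum (K + 1) d = eulerianNum (K + 1) (K - d) := by
  refine card_equiv (Equiv.mulLeft Fin.revPerm) fun σ => ?_
  have := descentCount_revPerm_mul σ
  simp only [mem_filter, mem_univ, true_and, Equiv.coe_mulLeft]
  omega

theorem isBalanced_decomposeFin_symm_iff {K : ℕ} (e : Equiv.Perm (Fin (K + 1))) :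
    IsBalanced (Equiv.Perm.decomposeFin.symm (0, e)) ↔
      (K : ℤ) - 2 * descentCount e = 1 ∨ (K : ℤ) - 2 * descentCount e = -1 := by
  set σ := Equiv.Perm.decomposeFin.symm (0, e) with hσ
  have hzero : σ 0 = 0 := by simp [hσ]
  have hsucc : ∀ i, σ i.succ = (e i).succ := fun i => by simp [hσ]
  have hofNat : ∀ j ≤ K, Fin.ofNat (K + 1 + 1) (j + 1) = (Fin.ofNat (K + 1) j).succ :=
    fun j hj => by
      ext
      simp only [Fin.val_ofNat, Fin.val_succ]
      rw [Nat.mod_eq_of_lt (by omega), Nat.mod_eq_of_lt (by omega)]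
  have hfirst : cyclicStep σ 0 = 1 := by
    have h0 : Fin.ofNat (K + 1 + 1) 0 = 0 := rfl
    rw [cyclicStep, hofNat 0 (by omega), hsucc, h0, hzero, if_pos (Fin.succ_pos _)]
  have hlast : cyclicStep σ (K + 1) = -1 := by
    have h0 : Fin.ofNat (K + 1 + 1) (K + 1 + 1) = 0 := by ext; simp
    rw [cyclicStep, h0, hzero, if_neg (Fin.not_lt_zero _)]
  have hmid : ∑ j ∈ range K, cyclicStep σ (j + 1) = ∑ j ∈ range K, cyclicStep e j := by
    refine sum_congr rfl fun j hj => ?_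
    have hj := mem_range.1 hj
    rw [cyclicStep, cyclicStep, hofNat j (by omega), hofNat (j + 1) (by omega), hsucc, hsucc]
    simp only [Fin.succ_lt_succ_iff]
  unfold IsBalanced
  rw [sum_range_succ, sum_range_succ', hfirst, hlast, hmid, sum_cyclicStep_range]
  simp

theorem card_balanced_zero {m : ℕ} :
    (univ.filter fun σ : Equiv.Perm (Fin (2 * (m + 1) + 1)) => IsBalanced σ ∧ σ 0 = 0).card =
      2 * eulerianNum (2 * (m + 1)) m := by
  have h1 : (univ.filter fun σ : Equiv.Perm (Fin (2 * (m + 1) + 1)) =>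
        IsBalanced σ ∧ σ 0 = 0).card =
      (univ.filter fun e : Equiv.Perm (Fin (2 * (m + 1))) =>
        descentCount e = m ∨ descentCount e = m + 1).card := by
    symm
    refine card_bij (fun e _ => Equiv.Perm.decomposeFin.symm (0, e)) (fun e he => ?_)
      (fun e _ e' _ h => by simpa using h) (fun σ hσ => ?_)
    · have := isBalanced_decomposeFin_symm_iff (K := 2 * m + 1) e
      simp only [mem_filter, mem_univ, true_and] at he ⊢
      refine ⟨this.2 ?_, by simp⟩
      push_cast
      omega
    · simp only [mem_filter, mem_univ, true_and] at hσ
      obtain ⟨⟨p, e⟩, rfl⟩ := Equiv.Perm.decomposeFin.symm.surjective σ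
      have hp : p = 0 := by simpa using hσ.2
      subst hp
      refine ⟨e, ?_, rfl⟩
      have := (isBalanced_decomposeFin_symm_iff (K := 2 * m + 1) e).1 hσ.1
      simp only [mem_filter, mem_univ, true_and]
      push_cast at this
      omega
  have h2 := eulerianNum_symm (K := 2 * m + 1) (d := m) (by omega)
  rw [show 2 * m + 1 - m = m + 1 by omega] at h2
  rw [h1, filter_or, card_union_of_disjoint, two_mul (eulerianNum _ _)]
  · exact congrArg (eulerianNum (2 * (m + 1)) m + ·) h2.symm
  · rw [disjoint_filter]
    intros
    omega

theorem ballot_eq_odd_order_max_descents (n : ℕ) :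
    bCount (2 * n + 1) n = pCount (2 * n + 1) n ∧
      bCount (2 * n + 1) n = eulerianCatalan n := by
  rcases n with _ | m
  · have hb : bCount (2 * 0 + 1) 0 = 1 := by
      have h : ∀ σ : Equiv.Perm (Fin (2 * 0 + 1)), IsBallot σ ∧ descentCount σ = 0 := fun σ => by
        have := sum_cyclicStep_range σ
        refine ⟨(isBallot_iff_s5 σ).2 fun m hm => ?_, ?_⟩
        · simp [Nat.le_zero.1 hm]
        · simpa using this
      rw [bCount, filter_true_of_mem fun σ _ => h σ]
      simp
    have hp : pCount (2 * 0 + 1) 0 = 1 := by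
      have h : ∀ σ : Equiv.Perm (Fin (2 * 0 + 1)), Odd (orderOf σ) ∧ permM σ = 0 := fun σ => by
        have : σ = 1 := Equiv.ext fun i => Fin.ext (by omega)
        subst this
        simp [permM]
      rw [pCount, filter_true_of_mem fun σ _ => h σ]
      simp
    rw [hb, hp]
    simp [eulerianCatalan]
  · have hb := card_transversal_eq (n := m + 1) (by omega)
        (fun σ => IsBallot σ ∧ descentCount σ = m + 1) (fun σ hσ => isBalanced_of_descentCount hσ.2)
        (fun σ hσ => existsUnique_ballot_rotation hσ)
    have hz := card_transversal_eq (n := m + 1) (by omega) (fun σ => IsBalanced σ ∧ σ 0 = 0)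
      (fun σ hσ => hσ.1) (fun σ hσ => by
        have hbal : ∀ k, IsBalanced (σ * Equiv.addRight k) := fun k => by
          rw [isBalanced_iff_cycleM (by omega)] at hσ ⊢
          rwa [← (toCycle_eq_iff σ _).2 ⟨k, rfl⟩]
        refine ⟨σ⁻¹ 0, ⟨hbal _, by simp⟩, fun k hk => ?_⟩
        have : σ k = 0 := by simpa using hk.2
        simp [← this])
    rw [card_balanced_zero] at hz
    refine ⟨hb.trans ?_, hb.trans (hz.symm.trans (by simp [eulerianCatalan]))⟩
    unfold pCount
    congr 1
    exact filter_congr fun c _ => (odd_order_and_permM_eq_iff (by omega) c).symm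
end
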